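/- arXiv:2411.07880 — 4 statements merged into one kernel-verified Lean document; each statement's English description precedes it below -/
import Mathlib

section
/- Let $K$ be a finite unramified extension of $\mathbb{Q}_p$ with $p \nmid n$, and let $a, b \in \mathcal{O}_K$ be nonzero with $v(a) = v(b)$ such that $K(\sqrt[n]{a})$ and $K(\sqrt[n]{b})$ are both totally ramified of degree $n$ over $K$. Then $K(\sqrt[n]{a}) \cong K(\sqrt[n]{b})$ as extensions of $K$ if and only if the unit $a/b \in \mathcal{O}_K^\times$ is an $n$-th power modulo $p$ (i.e., its image in the residue field is an $n$-th power). -/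
open Polynomial

namespace RatVal

section Basic

variable {F : Type*} [Field F] {v : F → ℚ}

theorem val_one (hmul : ∀ x y : F, x ≠ 0 → y ≠ 0 → v (x * y) = v x + v y) : v 1 = 0 := by
  have := hmul 1 1 one_ne_zero one_ne_zero
  rw [mul_one] at this
  linarith

theorem val_neg (hmul : ∀ x y : F, x ≠ 0 → y ≠ 0 → v (x * y) = v x + v y) {x : F} (hx : x ≠ 0) :
    v (-x) = v x := by
  have h1 := hmul (-1) (-1) (neg_ne_zero.2 one_ne_zero) (neg_ne_zero.2 one_ne_zero)
  have h2 := hmul (-1) x (neg_ne_zero.2 one_ne_zero) hx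
  rw [neg_mul_neg, mul_one, val_one hmul] at h1
  rw [neg_one_mul] at h2
  linarith

theorem val_inv (hmul : ∀ x y : F, x ≠ 0 → y ≠ 0 → v (x * y) = v x + v y) {x : F} (hx : x ≠ 0) :
    v x⁻¹ = -v x := by
  have h := hmul x x⁻¹ hx (inv_ne_zero hx)
  rw [mul_inv_cancel₀ hx, val_one hmul] at h
  linarith

theorem val_div (hmul : ∀ x y : F, x ≠ 0 → y ≠ 0 → v (x * y) = v x + v y) {x y : F} (hx : x ≠ 0)
    (hy : y ≠ 0) : v (x / y) = v x - v y := by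
  rw [div_eq_mul_inv, hmul _ _ hx (inv_ne_zero hy), val_inv hmul hy, sub_eq_add_neg]

theorem val_pow (hmul : ∀ x y : F, x ≠ 0 → y ≠ 0 → v (x * y) = v x + v y) {x : F} (hx : x ≠ 0)
    (k : ℕ) : v (x ^ k) = k * v x := by
  induction k with
  | zero => simp [val_one hmul]
  | succ k ih =>
    rw [pow_succ, hmul _ _ (pow_ne_zero _ hx) hx, ih]
    push_cast
    ring

theorem add_of_lt (hmul : ∀ x y : F, x ≠ 0 → y ≠ 0 → v (x * y) = v x + v y)
    (hadd : ∀ x y : F, x ≠ 0 → y ≠ 0 → x + y ≠ 0 → min (v x) (v y) ≤ v (x + y))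
    {x y : F} (hx : x ≠ 0) (hy : y ≠ 0) (h : v x < v y) : x + y ≠ 0 ∧ v (x + y) = v x := by
  have h0 : x + y ≠ 0 := by
    intro h0
    rw [eq_neg_of_add_eq_zero_left h0, val_neg hmul hy] at h
    exact lt_irrefl _ h
  refine ⟨h0, ?_⟩
  have h1 := hadd x y hx hy h0
  rw [min_eq_left h.le] at h1
  have h2 := hadd (x + y) (-y) h0 (neg_ne_zero.2 hy) (by simpa using hx)
  rw [val_neg hmul hy, add_neg_cancel_right] at h2
  rcases min_le_iff.1 h2 with h2 | h2 <;> linarith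

theorem sum_of_injOn (hmul : ∀ x y : F, x ≠ 0 → y ≠ 0 → v (x * y) = v x + v y)
    (hadd : ∀ x y : F, x ≠ 0 → y ≠ 0 → x + y ≠ 0 → min (v x) (v y) ≤ v (x + y))
    {ι : Type*} {s : Finset ι} (hs : s.Nonempty) {f : ι → F} (hf : ∀ i ∈ s, f i ≠ 0)
    (hinj : Set.InjOn (fun i ↦ v (f i)) s) :
    ∑ i ∈ s, f i ≠ 0 ∧ (∃ j ∈ s, v (∑ i ∈ s, f i) = v (f j)) ∧
      ∀ j ∈ s, v (∑ i ∈ s, f i) ≤ v (f j) := by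
  classical
  induction hs using Finset.Nonempty.cons_induction with
  | singleton a => simpa using hf
  | cons a s ha hs ih =>
    obtain ⟨h0, ⟨j, hj, hjv⟩, hle⟩ := ih (fun i hi ↦ hf i (Finset.mem_cons_of_mem hi))
      (hinj.mono (by simp))
    have ha0 : f a ≠ 0 := hf a (by simp)
    have hne : v (f a) ≠ v (∑ i ∈ s, f i) := by
      rw [hjv]
      intro h
      have := hinj (by simp) (by simp [hj]) h
      exact ha (this ▸ hj)
    rw [Finset.sum_cons]
    rcases lt_or_gt_of_ne hne with h | h
    · obtain ⟨h1, h2⟩ := add_of_lt hmul hadd ha0 h0 h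
      refine ⟨h1, ⟨a, by simp, h2⟩, fun k hk ↦ ?_⟩
      rw [h2]
      rcases Finset.mem_cons.1 hk with rfl | hk
      · exact le_rfl
      · exact h.le.trans (hle k hk)
    · obtain ⟨h1, h2⟩ := add_of_lt hmul hadd h0 ha0 h
      rw [add_comm] at h1 h2
      refine ⟨h1, ⟨j, by simp [hj], h2.trans hjv⟩, fun k hk ↦ ?_⟩
      rw [h2]
      rcases Finset.mem_cons.1 hk with rfl | hk
      · exact h.le
      · exact hle k hk

theorem pos_add (hadd : ∀ x y : F, x ≠ 0 → y ≠ 0 → x + y ≠ 0 → min (v x) (v y) ≤ v (x + y))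
    {x y : F} (hx : x = 0 ∨ 0 < v x) (hy : y = 0 ∨ 0 < v y) : x + y = 0 ∨ 0 < v (x + y) := by
  by_cases hx0 : x = 0
  · simpa [hx0] using hy
  by_cases hy0 : y = 0
  · simpa [hy0] using hx
  refine or_iff_not_imp_left.2 fun h ↦ ?_
  exact (lt_min (hx.resolve_left hx0) (hy.resolve_left hy0)).trans_le (hadd x y hx0 hy0 h)

/-- The valuation ring `{x | x = 0 ∨ 0 ≤ v x}` of a rational-valued valuation. -/
def integers (hmul : ∀ x y : F, x ≠ 0 → y ≠ 0 → v (x * y) = v x + v y)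
    (hadd : ∀ x y : F, x ≠ 0 → y ≠ 0 → x + y ≠ 0 → min (v x) (v y) ≤ v (x + y)) :
    ValuationSubring F where
  carrier := {x | x = 0 ∨ 0 ≤ v x}
  zero_mem' := Or.inl rfl
  one_mem' := Or.inr (val_one hmul).ge
  add_mem' := by
    intro x y hx hy
    by_cases hx0 : x = 0
    · simpa [hx0] using hy
    by_cases hy0 : y = 0
    · simpa [hy0] using hx
    refine or_iff_not_imp_left.2 fun h ↦ ?_
    exact (le_min (hx.resolve_left hx0) (hy.resolve_left hy0)).trans (hadd x y hx0 hy0 h)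
  mul_mem' := by
    intro x y hx hy
    by_cases hx0 : x = 0
    · simp [hx0]
    by_cases hy0 : y = 0
    · simp [hy0]
    refine Or.inr ?_
    rw [hmul x y hx0 hy0]
    exact add_nonneg (hx.resolve_left hx0) (hy.resolve_left hy0)
  neg_mem' := by
    intro x hx
    by_cases hx0 : x = 0
    · simp [hx0]
    refine Or.inr ?_
    rw [val_neg hmul hx0]
    exact hx.resolve_left hx0
  mem_or_inv_mem' := by
    intro x
    by_cases hx0 : x = 0
    · simp [hx0]
    rcases le_total 0 (v x) with h | h
    · exact Or.inl (Or.inr h)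
    · refine Or.inr (Or.inr ?_)
      rw [val_inv hmul hx0]
      linarith

theorem mem_integers (hmul : ∀ x y : F, x ≠ 0 → y ≠ 0 → v (x * y) = v x + v y)
    (hadd : ∀ x y : F, x ≠ 0 → y ≠ 0 → x + y ≠ 0 → min (v x) (v y) ≤ v (x + y)) {x : F} :
    x ∈ integers hmul hadd ↔ x = 0 ∨ 0 ≤ v x := Iff.rfl

theorem pos_mul (hmul : ∀ x y : F, x ≠ 0 → y ≠ 0 → v (x * y) = v x + v y)
    {x y : F} (hx : x = 0 ∨ 0 < v x) (hy : y = 0 ∨ 0 ≤ v y) : x * y = 0 ∨ 0 < v (x * y) := by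
  by_cases hx0 : x = 0
  · simp [hx0]
  by_cases hy0 : y = 0
  · simp [hy0]
  refine Or.inr ?_
  rw [hmul x y hx0 hy0]
  exact add_pos_of_pos_of_nonneg (hx.resolve_left hx0) (hy.resolve_left hy0)

theorem mem_integers_of_monic (hmul : ∀ x y : F, x ≠ 0 → y ≠ 0 → v (x * y) = v x + v y)
    (hadd : ∀ x y : F, x ≠ 0 → y ≠ 0 → x + y ≠ 0 → min (v x) (v y) ≤ v (x + y))
    {f : F[X]} (hf : f.Monic) (hc : ∀ i, f.coeff i ∈ integers hmul hadd) {x : F}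
    (hx : f.eval x = 0) : x ∈ integers hmul hadd := by
  set A := integers hmul hadd
  have hl : f ∈ lifts (algebraMap A F) := by
    rw [lifts_iff_coeff_lifts]
    exact fun i ↦ ⟨⟨_, hc i⟩, rfl⟩
  obtain ⟨g, hg, -, hgm⟩ := lifts_and_degree_eq_and_monic hl hf
  have hi : IsIntegral A x := ⟨g, hgm, by rw [← eval_map, hg, hx]⟩
  obtain ⟨y, rfl⟩ := IsIntegrallyClosed.isIntegral_iff.1 hi
  exact y.2

end Basic

theorem exists_pow_eq_one_add {p : ℕ} [Fact p.Prime] {l : ℕ} (hl : ¬ p ∣ l) (w : ℤ_[p]) :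
    ∃ t : ℤ_[p], t ^ l = 1 + p * w := by
  have hp := (Fact.out : p.Prime)
  have hnl : ‖(l : ℤ_[p])‖ = 1 := by
    rw [PadicInt.norm_natCast_eq_one_iff]
    exact (hp.coprime_iff_not_dvd).2 hl
  have hn : ‖(X ^ l - C (1 + (p : ℤ_[p]) * w)).aeval (1 : ℤ_[p])‖
      < ‖(X ^ l - C (1 + (p : ℤ_[p]) * w)).derivative.aeval (1 : ℤ_[p])‖ ^ 2 := by
    have h1 : ‖(p : ℤ_[p]) * w‖ < 1 := by
      rw [norm_mul]
      calc _ ≤ ‖(p : ℤ_[p])‖ * 1 := by gcongr; exact PadicInt.norm_le_one w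
        _ < 1 := by
          rw [mul_one, PadicInt.norm_p]
          exact inv_lt_one_of_one_lt₀ (by exact_mod_cast hp.one_lt)
    simpa [hnl, derivative_X_pow] using h1
  obtain ⟨z, hz, -⟩ := hensels_lemma hn
  refine ⟨z, ?_⟩
  simpa [sub_eq_zero] using hz

theorem nonneg_padicInt {p : ℕ} [Fact p.Prime] {v : ℚ_[p] → ℚ}
    (hmul : ∀ x y, x ≠ 0 → y ≠ 0 → v (x * y) = v x + v y)
    (hadd : ∀ x y, x ≠ 0 → y ≠ 0 → x + y ≠ 0 → min (v x) (v y) ≤ v (x + y))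
    (hvp : v p = 1) (hint : ∀ x, x ≠ 0 → ∃ m : ℤ, v x = m) {z : ℚ_[p]} (hz : ‖z‖ ≤ 1)
    (hz0 : z ≠ 0) : 0 ≤ v z := by
  by_contra! hlt
  have hp := (Fact.out : p.Prime)
  have hp0 : (p : ℚ_[p]) ≠ 0 := by exact_mod_cast hp.ne_zero
  obtain ⟨m, hm⟩ := hint z hz0
  have hm0 : m < 0 := by rw [hm] at hlt; exact_mod_cast hlt
  have hpz0 : (p : ℚ_[p]) * z ^ 2 ≠ 0 := mul_ne_zero hp0 (pow_ne_zero _ hz0)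
  have hpz : v (p * z ^ 2) = ((1 + 2 * m : ℤ) : ℚ) := by
    rw [hmul _ _ hp0 (pow_ne_zero _ hz0), hvp, val_pow hmul hz0, hm]
    push_cast
    ring
  obtain ⟨hu0, hu⟩ := add_of_lt hmul hadd hpz0 one_ne_zero (by
    rw [hpz, val_one hmul]
    exact_mod_cast (by omega : 1 + 2 * m < 0))
  set l : ℕ := p * (1 + 2 * m).natAbs + 1 with hl
  have hpl : ¬ p ∣ l := by
    rw [hl, Nat.dvd_add_right (dvd_mul_right _ _)]
    exact hp.not_dvd_one
  obtain ⟨w, rfl⟩ : ∃ w : ℤ_[p], (w : ℚ_[p]) = z := ⟨⟨z, hz⟩, rfl⟩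
  obtain ⟨t, ht⟩ := exists_pow_eq_one_add hpl (w ^ 2)
  have ht' : (t : ℚ_[p]) ^ l = p * (w : ℚ_[p]) ^ 2 + 1 := by
    have := congrArg (fun x : ℤ_[p] ↦ (x : ℚ_[p])) ht
    push_cast at this
    rw [this, add_comm]
  have ht0 : (t : ℚ_[p]) ≠ 0 := by
    intro h
    rw [h, zero_pow (by omega)] at ht'
    exact hu0 ht'.symm
  obtain ⟨k, hk⟩ := hint t ht0
  rw [← ht', val_pow hmul ht0, hk, hpz] at hu
  have hdvd : (l : ℤ) ∣ 1 + 2 * m := ⟨k, by exact_mod_cast hu.symm⟩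
  have hle := Nat.le_of_dvd (by omega) (Int.natCast_dvd.1 hdvd)
  have := Nat.le_mul_of_pos_left (1 + 2 * m).natAbs hp.pos
  omega

section Padic

variable {p : ℕ} [Fact p.Prime] {K : Type*} [Field K] [Algebra ℚ_[p] K]
  [Algebra.IsAlgebraic ℚ_[p] K]

theorem spectralNorm_lt_one {v : K → ℚ}
    (hmul : ∀ x y, x ≠ 0 → y ≠ 0 → v (x * y) = v x + v y)
    (hadd : ∀ x y, x ≠ 0 → y ≠ 0 → x + y ≠ 0 → min (v x) (v y) ≤ v (x + y))
    (hvp : v p = 1) (hint : ∀ x, x ≠ 0 → ∃ m : ℤ, v x = m) {x : K} (hx : x = 0 ∨ 0 < v x) :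
    spectralNorm ℚ_[p] K x < 1 := by
  rcases eq_or_ne x 0 with rfl | hx0
  · simp [spectralNorm_zero]
  have hpos := hx.resolve_left hx0
  by_contra! hge
  have hN : spectralNorm ℚ_[p] K x⁻¹ ≤ 1 := by
    have h := map_mul (spectralMulAlgNorm ℚ_[p] K) x x⁻¹
    rw [mul_inv_cancel₀ hx0, map_one] at h
    change 1 = spectralNorm ℚ_[p] K x * spectralNorm ℚ_[p] K x⁻¹ at h
    nlinarith [spectralNorm_nonneg (K := ℚ_[p]) x⁻¹]
  have hi : IsIntegral ℚ_[p] x⁻¹ := Algebra.IsIntegral.isIntegral _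
  rw [spectralNorm, spectralValue_le_one_iff (minpoly.monic hi)] at hN
  have hne {z : ℚ_[p]} (hz : z ≠ 0) : algebraMap ℚ_[p] K z ≠ 0 := by simpa using hz
  have hcoef (i : ℕ) :
      ((minpoly ℚ_[p] x⁻¹).map (algebraMap ℚ_[p] K)).coeff i ∈ integers hmul hadd := by
    rw [coeff_map, mem_integers]
    by_cases h0 : (minpoly ℚ_[p] x⁻¹).coeff i = 0
    · left; simp [h0]
    refine Or.inr (nonneg_padicInt (v := fun z ↦ v (algebraMap ℚ_[p] K z)) ?_ ?_ ?_ ?_ (hN i) h0)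
    · intro x y hx hy
      rw [map_mul, hmul _ _ (hne hx) (hne hy)]
    · intro x y hx hy hxy
      rw [map_add]
      refine hadd _ _ (hne hx) (hne hy) ?_
      rw [← map_add]
      exact hne hxy
    · simpa using hvp
    · exact fun x hx ↦ hint _ (hne hx)
  have := mem_integers_of_monic hmul hadd ((minpoly.monic hi).map _) hcoef (x := x⁻¹)
    (by rw [eval_map_algebraMap, minpoly.aeval])
  rcases this with h | h
  · exact inv_ne_zero hx0 h
  · rw [val_inv hmul hx0] at h
    linarith

theorem eq_one_of_pow_eq_one_of_spectralNorm_lt_one {L : Type*} [Field L] [Algebra ℚ_[p] L]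
    [Algebra.IsAlgebraic ℚ_[p] L] {n : ℕ} (hpn : ¬ p ∣ n) {z : L} (hz : z ^ n = 1)
    (h : spectralNorm ℚ_[p] L (z - 1) < 1) : z = 1 := by
  have hp := (Fact.out : p.Prime)
  have hn0 : n ≠ 0 := by rintro rfl; exact hpn (dvd_zero p)
  let N := spectralMulAlgNorm ℚ_[p] L
  have hna : IsNonarchimedean N := isNonarchimedean_spectralNorm
  change N (z - 1) < 1 at h
  have hzN : N z = 1 := by
    have := map_pow N z n
    rw [hz, map_one] at this
    exact (pow_eq_one_iff_of_nonneg (apply_nonneg N z) hn0).1 this.symm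
  have hpow (i : ℕ) : N (z ^ i - 1) < 1 := by
    induction i with
    | zero => simp
    | succ i ih =>
      have : z ^ (i + 1) - 1 = z * (z ^ i - 1) + (z - 1) := by ring
      rw [this]
      refine (hna _ _).trans_lt (max_lt ?_ h)
      rwa [map_mul, hzN, one_mul]
  by_contra hne
  have hgeom : ∑ i ∈ Finset.range n, z ^ i = 0 := by
    have := geom_sum_mul z n
    rw [hz, sub_self] at this
    exact (mul_eq_zero.1 this).resolve_right (sub_ne_zero.2 hne)
  have hsum : N (∑ i ∈ Finset.range n, (z ^ i - 1)) < 1 :=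
    Finset.sum_induction _ (fun x ↦ N x < 1) (fun x y hx hy ↦ (hna x y).trans_lt (max_lt hx hy))
      (by simp) (fun i _ ↦ hpow i)
  rw [Finset.sum_sub_distrib, hgeom, zero_sub, map_neg_eq_map] at hsum
  have hn : N (n : L) = 1 := by
    have h1 := spectralNorm_extends (K := ℚ_[p]) (L := L) (n : ℚ_[p])
    rw [map_natCast, Padic.norm_natCast_eq_one_iff.2 ((hp.coprime_iff_not_dvd).2 hpn)] at h1
    exact h1
  simp [hn] at hsum

theorem exists_pow_eq_of_spectralNorm_lt_one {n : ℕ} (hpn : ¬ p ∣ n) {y : K}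
    (hy : spectralNorm ℚ_[p] K (1 - y) < 1) : ∃ e : K, e ^ n = y := by
  have hn0 : n ≠ 0 := by rintro rfl; exact hpn (dvd_zero p)
  let L := AlgebraicClosure K
  let N := spectralMulAlgNorm ℚ_[p] L
  have : CharZero K := charZero_of_injective_algebraMap (algebraMap ℚ_[p] K).injective
  have : Algebra.IsAlgebraic ℚ_[p] L := Algebra.IsAlgebraic.trans ℚ_[p] K L
  rw [spectralNorm.eq_of_tower (L := L)] at hy
  change N _ < 1 at hy
  have hna : IsNonarchimedean N := isNonarchimedean_spectralNorm
  set f : L[X] := X ^ n - C (algebraMap K L y) with hf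
  have hfm : f.Monic := monic_X_pow_sub_C _ hn0
  obtain ⟨e, he, heN⟩ : ∃ e ∈ f.roots, N (1 - e) < 1 := by
    by_contra! hall
    have hprod (s : Multiset L) (hs : ∀ a ∈ s, 1 ≤ N (1 - a)) :
        1 ≤ N ((s.map fun a ↦ 1 - a).prod) := by
      induction s using Multiset.induction with
      | empty => simp
      | cons a s ih =>
        rw [Multiset.map_cons, Multiset.prod_cons, map_mul]
        exact one_le_mul_of_one_le_of_one_le (hs a (by simp))
          (ih fun b hb ↦ hs b (Multiset.mem_cons_of_mem hb))
    have h1 := hprod f.roots hall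
    have h2 := (IsAlgClosed.splits f).eval_eq_prod_roots_of_monic hfm 1
    rw [← h2] at h1
    simp only [hf, eval_sub, eval_pow, eval_X, one_pow, eval_C] at h1
    rw [map_sub, map_one] at hy
    exact hy.not_ge h1
  have hen : e ^ n = algebraMap K L y := by
    have := (mem_roots hfm.ne_zero).1 he
    simpa [hf, sub_eq_zero] using this
  have he1 : N e = 1 := by
    have h1 : N e ≤ 1 := by
      have h := hna 1 (-(1 - e))
      rw [map_neg_eq_map, map_one, max_eq_left heN.le] at h
      simpa using h
    have h2 := hna (1 - e) e
    rw [sub_add_cancel, map_one] at h2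
    exact h1.antisymm ((le_max_iff.1 h2).resolve_left heN.not_ge)
  have he0 : e ≠ 0 := by
    rintro rfl
    simp at he1
  have hfix (σ : Gal(L/K)) : σ e = e := by
    have hσN : N (1 - σ e) < 1 := by
      have h := spectralNorm_eq_of_equiv (K := ℚ_[p]) (σ.restrictScalars ℚ_[p]) (1 - e)
      rw [AlgEquiv.restrictScalars_apply, map_sub, map_one] at h
      change N _ = N _ at h
      rwa [← h]
    have h1 : (σ e / e) ^ n = 1 := by
      rw [div_pow, ← map_pow, hen, AlgEquiv.commutes, ← hen, div_self (pow_ne_zero _ he0)]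
    have h2 : N (σ e / e - 1) < 1 := by
      have : N (σ e / e - 1) * N e < 1 := by
        rw [← map_mul, sub_mul, div_mul_cancel₀ _ he0, one_mul]
        have : σ e - e = (1 - e) + -(1 - σ e) := by ring
        rw [this]
        refine (hna _ _).trans_lt (max_lt heN ?_)
        rwa [map_neg_eq_map]
      rwa [he1, mul_one] at this
    exact (div_eq_one_iff_eq he0).1 (eq_one_of_pow_eq_one_of_spectralNorm_lt_one hpn h1 h2)
  obtain ⟨c, hc⟩ := (InfiniteGalois.mem_range_algebraMap_iff_fixed e).2 hfix
  refine ⟨c, (algebraMap K L).injective ?_⟩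
  rw [map_pow, hc, hen]

end Padic

section TotallyRamified

variable {K L : Type*} [Field K] [Field L] [Algebra K L] {v : L → ℚ}

theorem val_smul_pow (hmul : ∀ x y : L, x ≠ 0 → y ≠ 0 → v (x * y) = v x + v y)
    {n : ℕ} {x : L} (hx0 : x ≠ 0) (hx : v x = 1 / n) {k : K} (hk : k ≠ 0) (i : ℕ) :
    v (k • x ^ i) = v (algebraMap K L k) + i / n := by
  rw [Algebra.smul_def, hmul _ _ (by simpa using hk) (pow_ne_zero _ hx0), val_pow hmul hx0, hx]
  ring

theorem injOn_val_smul_pow (hmul : ∀ x y : L, x ≠ 0 → y ≠ 0 → v (x * y) = v x + v y)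
    (hur : ∀ k : K, k ≠ 0 → ∃ m : ℤ, v (algebraMap K L k) = m)
    {n : ℕ} {x : L} (hx0 : x ≠ 0) (hx : v x = 1 / n) (c : Fin n → K) :
    Set.InjOn (fun i : Fin n ↦ v (c i • x ^ (i : ℕ))) {i | c i ≠ 0} := by
  intro i hi j hj h
  have hn : (n : ℚ) ≠ 0 := by
    have := i.pos
    positivity
  obtain ⟨a, ha⟩ := hur _ hi
  obtain ⟨b, hb⟩ := hur _ hj
  simp only [val_smul_pow hmul hx0 hx hi, val_smul_pow hmul hx0 hx hj, ha, hb] at h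
  field_simp at h
  have h' : (n : ℤ) * a + (i : ℕ) = n * b + (j : ℕ) := by
    have : (n : ℚ) * a + (i : ℕ) = n * b + (j : ℕ) := by linarith
    exact_mod_cast this
  have hm := congrArg (· % (n : ℤ)) h'
  simp only [Int.mul_add_emod_self_left] at hm
  rw [Int.emod_eq_of_lt (by omega) (by omega), Int.emod_eq_of_lt (by omega) (by omega)] at hm
  exact Fin.ext (by exact_mod_cast hm)

theorem exists_sub_algebraMap_pos (hmul : ∀ x y : L, x ≠ 0 → y ≠ 0 → v (x * y) = v x + v y)
    (hadd : ∀ x y : L, x ≠ 0 → y ≠ 0 → x + y ≠ 0 → min (v x) (v y) ≤ v (x + y))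
    (hur : ∀ k : K, k ≠ 0 → ∃ m : ℤ, v (algebraMap K L k) = m)
    {n : ℕ} (hn : n ≠ 0) (hdeg : Module.finrank K L = n) {x : L} (hx0 : x ≠ 0) (hx : v x = 1 / n)
    {u : L} (hu0 : u ≠ 0) (hu : v u = 0) :
    ∃ c : K, c ≠ 0 ∧ 0 ≤ v (algebraMap K L c) ∧
      (u - algebraMap K L c = 0 ∨ 0 < v (u - algebraMap K L c)) := by
  classical
  have : NeZero n := ⟨hn⟩
  have hterm (c : Fin n → K) (i : Fin n) (hi : c i ≠ 0) : c i • x ^ (i : ℕ) ≠ 0 :=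
    smul_ne_zero hi (pow_ne_zero _ hx0)
  have hfilter (c : Fin n → K) :
      ∑ i with c i ≠ 0, c i • x ^ (i : ℕ) = ∑ i, c i • x ^ (i : ℕ) := by
    refine Finset.sum_filter_of_ne fun i _ hi h ↦ hi ?_
    rw [h, zero_smul]
  have hsum (c : Fin n → K) (hc : ∃ i, c i ≠ 0) :=
    sum_of_injOn hmul hadd (s := {i | c i ≠ 0}) (f := fun i ↦ c i • x ^ (i : ℕ))
      (by simpa [Finset.Nonempty] using hc) (fun i hi ↦ hterm c i (by simpa using hi))
      (by simpa using injOn_val_smul_pow hmul hur hx0 hx c)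
  have hli : LinearIndependent K fun i : Fin n ↦ x ^ (i : ℕ) := by
    rw [Fintype.linearIndependent_iff]
    intro c hc
    by_contra! h
    exact (hsum c h).1 ((hfilter c).trans hc)
  have hspan := hli.span_eq_top_of_card_eq_finrank (by simp [hdeg])
  obtain ⟨c, rfl⟩ : ∃ c : Fin n → K, ∑ i, c i • x ^ (i : ℕ) = u := by
    rw [← Submodule.mem_span_range_iff_exists_fun, hspan]
    trivial
  have hc : ∃ i, c i ≠ 0 := by
    by_contra! h
    simp [h] at hu0
  obtain ⟨-, -, hle⟩ := hsum c hc
  rw [hfilter, hu] at hle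
  have hpos (i : Fin n) (hi : i ≠ 0) : c i • x ^ (i : ℕ) = 0 ∨ 0 < v (c i • x ^ (i : ℕ)) := by
    rcases eq_or_ne (c i) 0 with h | h
    · simp [h]
    refine Or.inr ((hle i (by simpa using h)).lt_of_ne' ?_)
    rw [val_smul_pow hmul hx0 hx h]
    obtain ⟨m, hm⟩ := hur _ h
    have hn' : (n : ℚ) ≠ 0 := by exact_mod_cast hn
    rw [hm]
    intro h0
    have h0' : (n : ℤ) * m + (i : ℕ) = 0 := by
      have : (n : ℚ) * m + (i : ℕ) = 0 := by
        field_simp at h0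
        linarith
      exact_mod_cast this
    have hdvd : (n : ℤ) ∣ (i : ℕ) := ⟨-m, by linarith⟩
    have := Nat.eq_zero_of_dvd_of_lt (Int.natCast_dvd_natCast.1 hdvd) i.2
    exact hi (Fin.ext (by simpa using this))
  have htail : ∑ i ∈ Finset.univ.erase 0, c i • x ^ (i : ℕ) = 0 ∨
      0 < v (∑ i ∈ Finset.univ.erase 0, c i • x ^ (i : ℕ)) :=
    Finset.sum_induction _ (fun y ↦ y = 0 ∨ 0 < v y) (fun _ _ ↦ pos_add hadd) (Or.inl rfl)
      fun i hi ↦ hpos i (Finset.ne_of_mem_erase hi)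
  have hsplit : ∑ i, c i • x ^ (i : ℕ) =
      algebraMap K L (c 0) + ∑ i ∈ Finset.univ.erase 0, c i • x ^ (i : ℕ) := by
    rw [← Finset.add_sum_erase _ _ (Finset.mem_univ (0 : Fin n)), Fin.val_zero, pow_zero,
      Algebra.algebraMap_eq_smul_one]
  have hc0 : c 0 ≠ 0 := by
    intro h
    rw [h, map_zero, zero_add] at hsplit
    rw [← hsplit, hu] at htail
    exact htail.elim hu0 (lt_irrefl _)
  refine ⟨c 0, hc0, ?_, ?_⟩
  · have := hle 0 (by simpa using hc0)
    rwa [Fin.val_zero, pow_zero, ← Algebra.algebraMap_eq_smul_one] at this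
  · rwa [hsplit, add_sub_cancel_left]

end TotallyRamified

theorem pos_pow_sub_pow {F : Type*} [Field F] {v : F → ℚ}
    (hmul : ∀ x y : F, x ≠ 0 → y ≠ 0 → v (x * y) = v x + v y)
    (hadd : ∀ x y : F, x ≠ 0 → y ≠ 0 → x + y ≠ 0 → min (v x) (v y) ≤ v (x + y))
    {x y : F} (hx : x = 0 ∨ 0 ≤ v x) (hy : y = 0 ∨ 0 ≤ v y) (h : x - y = 0 ∨ 0 < v (x - y))
    (n : ℕ) : x ^ n - y ^ n = 0 ∨ 0 < v (x ^ n - y ^ n) := by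
  rw [← (Commute.all x y).mul_geom_sum₂]
  refine pos_mul hmul h ?_
  rw [← mem_integers hmul hadd] at hx hy ⊢
  exact sum_mem fun i _ ↦ mul_mem (pow_mem hx _) (pow_mem hy _)

end RatVal

/-- For `a, b ∈ 𝒪_K` nonzero with `v(a) = v(b)` and `K(ⁿ√a)`, `K(ⁿ√b)` totally
ramified of degree `n` (`p ∤ n`): `K(ⁿ√a) ≅ K(ⁿ√b)` over `K` iff `a/b` is an
`n`-th power modulo `p`. -/
theorem stmt_5 (p : ℕ) [Fact p.Prime]
    (K Ω : Type) [Field K] [Algebra ℚ_[p] K] [FiniteDimensional ℚ_[p] K]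
    [Field Ω] [Algebra K Ω] [IsAlgClosed Ω] [Algebra.IsAlgebraic K Ω]
    (v : Ω → ℚ)
    (hmul : ∀ x y : Ω, x ≠ 0 → y ≠ 0 → v (x * y) = v x + v y)
    (hadd : ∀ x y : Ω, x ≠ 0 → y ≠ 0 → x + y ≠ 0 → min (v x) (v y) ≤ v (x + y))
    (hvp : v ((p : Ω)) = 1)
    (hur : ∀ x : K, x ≠ 0 → ∃ m : ℤ, v (algebraMap K Ω x) = (m : ℚ))
    (n : ℕ) (hpn : ¬ p ∣ n)
    (a b : K) (ha : a ≠ 0) (hb : b ≠ 0)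
    (hain : 0 ≤ v (algebraMap K Ω a)) (hbin : 0 ≤ v (algebraMap K Ω b))
    (hvab : v (algebraMap K Ω a) = v (algebraMap K Ω b))
    (γ δ : Ω) (hγ : γ ^ n = algebraMap K Ω a) (hδ : δ ^ n = algebraMap K Ω b)
    (hγdeg : Module.finrank K ↥(IntermediateField.adjoin K {γ}) = n)
    (hγtot : ∃ x : Ω, x ∈ IntermediateField.adjoin K {γ} ∧ x ≠ 0 ∧ v x = 1 / (n : ℚ))
    (hδdeg : Module.finrank K ↥(IntermediateField.adjoin K {δ}) = n)
    (hδtot : ∃ x : Ω, x ∈ IntermediateField.adjoin K {δ} ∧ x ≠ 0 ∧ v x = 1 / (n : ℚ)) :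
    Nonempty (↥(IntermediateField.adjoin K {γ}) ≃ₐ[K] ↥(IntermediateField.adjoin K {δ})) ↔
      ∃ c : K, 0 ≤ v (algebraMap K Ω c) ∧
        (a / b - c ^ n = 0 ∨ 1 ≤ v (algebraMap K Ω (a / b - c ^ n))) := by
  have hn0 : n ≠ 0 := by rintro rfl; exact hpn (dvd_zero p)
  have hne {k : K} (hk : k ≠ 0) : algebraMap K Ω k ≠ 0 := by simpa using hk
  have hδ0 : δ ≠ 0 := by
    rintro rfl
    rw [zero_pow hn0] at hδ
    exact hne hb hδ.symm
  have hvab0 : v (algebraMap K Ω (a / b)) = 0 := by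
    rw [map_div₀, RatVal.val_div hmul (hne ha) (hne hb), hvab, sub_self]
  constructor
  · rintro ⟨φ⟩
    obtain ⟨x, hxmem, hx0, hx⟩ := hδtot
    let L := IntermediateField.adjoin K {δ}
    let g : L := φ ⟨γ, IntermediateField.mem_adjoin_simple_self K γ⟩
    let d : L := ⟨δ, IntermediateField.mem_adjoin_simple_self K δ⟩
    have hg : g ^ n = algebraMap K L a := by
      rw [← map_pow, ← φ.commutes]
      exact congrArg φ (Subtype.ext hγ)
    have hd : d ^ n = algebraMap K L b := Subtype.ext hδ
    have hLne {y : L} (hy : y ≠ 0) : (y : Ω) ≠ 0 := by simpa using hy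
    have hun : (g / d) ^ n = algebraMap K L (a / b) := by
      rw [div_pow, hg, hd, map_div₀]
    have hu0 : g / d ≠ 0 := by
      intro h
      rw [h, zero_pow hn0] at hun
      exact (map_ne_zero (algebraMap K L)).2 (div_ne_zero ha hb) hun.symm
    have hmulL (y z : L) (hy : y ≠ 0) (hz : z ≠ 0) : v (y * z : L) = v y + v z :=
      hmul _ _ (hLne hy) (hLne hz)
    have haddL (y z : L) (hy : y ≠ 0) (hz : z ≠ 0) (hyz : y + z ≠ 0) :
        min (v y) (v z) ≤ v (y + z : L) := hadd _ _ (hLne hy) (hLne hz) (hLne hyz)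
    have hu : v (g / d : L) = 0 := by
      have h := RatVal.val_pow (v := fun y : L ↦ v y) hmulL hu0 n
      rw [hun] at h
      have h' : v (algebraMap K L (a / b) : L) = 0 := hvab0
      rw [h'] at h
      exact (mul_eq_zero.1 h.symm).resolve_left (by exact_mod_cast hn0)
    obtain ⟨c, -, hc, hcu⟩ := RatVal.exists_sub_algebraMap_pos (v := fun y : L ↦ v y) hmulL haddL
      hur hn0 hδdeg (x := ⟨x, hxmem⟩) (by simpa [Subtype.ext_iff] using hx0) hx hu0 hu
    refine ⟨c, hc, or_iff_not_imp_left.2 fun h0 ↦ ?_⟩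
    have hpow := RatVal.pos_pow_sub_pow (v := fun y : L ↦ v y) hmulL haddL (Or.inr hu.ge) (Or.inr hc)
      hcu n
    rw [hun, ← map_pow, ← map_sub] at hpow
    have hpos : 0 < v (algebraMap K Ω (a / b - c ^ n)) :=
      hpow.resolve_left ((map_ne_zero (algebraMap K L)).2 h0)
    obtain ⟨m, hm⟩ := hur _ h0
    rw [hm] at hpos ⊢
    have : 0 < m := by exact_mod_cast hpos
    exact_mod_cast this
  · rintro ⟨c, hc, hcn⟩
    let w : K → ℚ := fun k ↦ v (algebraMap K Ω k)
    have hmulK (x y : K) (hx : x ≠ 0) (hy : y ≠ 0) : w (x * y) = w x + w y := by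
      simp only [w, map_mul, hmul _ _ (hne hx) (hne hy)]
    have haddK (x y : K) (hx : x ≠ 0) (hy : y ≠ 0) (hxy : x + y ≠ 0) :
        min (w x) (w y) ≤ w (x + y) := by
      have := hadd _ _ (hne hx) (hne hy) (by rw [← map_add]; exact hne hxy)
      rwa [← map_add] at this
    have hcn' : a / b - c ^ n = 0 ∨ 0 < w (a / b - c ^ n) :=
      hcn.imp_right fun h ↦ one_pos.trans_le h
    have hab0 : a / b ≠ 0 := div_ne_zero ha hb
    have hc0 : c ≠ 0 := by
      rintro rfl
      rw [zero_pow hn0, sub_zero] at hcn'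
      exact hcn'.elim hab0 hvab0.not_gt
    have hquot : 1 - c ^ n / (a / b) = 0 ∨ 0 < w (1 - c ^ n / (a / b)) := by
      have : 1 - c ^ n / (a / b) = (a / b - c ^ n) * (a / b)⁻¹ := by
        field_simp
      rw [this]
      refine RatVal.pos_mul hmulK hcn' (Or.inr ?_)
      rw [RatVal.val_inv hmulK hab0]
      exact (neg_eq_zero.2 hvab0).ge
    obtain ⟨e, he⟩ := RatVal.exists_pow_eq_of_spectralNorm_lt_one hpn
      (RatVal.spectralNorm_lt_one hmulK haddK (by simpa [w] using hvp) hur hquot)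
    have he0 : e ≠ 0 := by
      rintro rfl
      rw [zero_pow hn0] at he
      exact div_ne_zero (pow_ne_zero n hc0) hab0 he.symm
    set k : K := c / e with hk
    have hk0 : k ≠ 0 := div_ne_zero hc0 he0
    have hkn : k ^ n * b = a := by
      rw [hk, div_pow, he]
      have := pow_ne_zero n hc0
      field_simp
    set η : Ω := algebraMap K Ω k * δ with hη
    have hηn : η ^ n = algebraMap K Ω a := by
      rw [hη, mul_pow, hδ, ← map_pow, ← map_mul, hkn]
    have hadj : IntermediateField.adjoin K {η} = IntermediateField.adjoin K {δ} := by
      apply le_antisymm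
      · rw [IntermediateField.adjoin_simple_le_iff]
        exact mul_mem (IntermediateField.algebraMap_mem _ _)
          (IntermediateField.mem_adjoin_simple_self K δ)
      · rw [IntermediateField.adjoin_simple_le_iff]
        have : δ = algebraMap K Ω k⁻¹ * η := by
          rw [hη, ← mul_assoc, ← map_mul, inv_mul_cancel₀ hk0, map_one, one_mul]
        rw [this]
        exact mul_mem (IntermediateField.algebraMap_mem _ _)
          (IntermediateField.mem_adjoin_simple_self K η)
    have hmin {ξ : Ω} (hξ : ξ ^ n = algebraMap K Ω a)
        (hdeg : Module.finrank K (IntermediateField.adjoin K {ξ}) = n) :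
        minpoly K ξ = X ^ n - C a := by
      have hi : IsIntegral K ξ := Algebra.IsIntegral.isIntegral ξ
      refine (eq_of_monic_of_dvd_of_natDegree_le (minpoly.monic hi) (monic_X_pow_sub_C a hn0)
        (minpoly.dvd K ξ (by simp [hξ])) ?_).symm
      rw [natDegree_X_pow_sub_C, ← IntermediateField.adjoin.finrank hi, hdeg]
    have heq : minpoly K γ = minpoly K η :=
      (hmin hγ hγdeg).trans (hmin hηn (by rw [hadj, hδdeg])).symm
    exact ⟨((IntermediateField.adjoin.powerBasis (Algebra.IsIntegral.isIntegral γ)).equivOfMinpoly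
      (IntermediateField.adjoin.powerBasis (Algebra.IsIntegral.isIntegral η))
      (by simpa [IntermediateField.minpoly_gen] using heq)).trans
      (IntermediateField.equivOfEq hadj)⟩
end

section
/- Let $K$ be a finite unramified extension of $\mathbb{Q}_p$, $p \nmid n$, and let $h(x) = \sum_{j=0}^n a_j x^j \in \mathcal{O}_K[x]$ be a $k$-Eisenstein polynomial with $\gcd(k,n)=1$. Then the discriminant $\Delta$ of $h$ has valuation $v(\Delta) = k(n-1)$, and its unit part $u = p^{-k(n-1)}\Delta$ satisfies $u \equiv (-1)^{n(n-1)/2} n^n a_n^{n-1} w^{n-1} \pmod p$, where $w = p^{-k} a_0$ is the unit part of $a_0$. -/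
open Polynomial Finset

def IsKEisenstein {K : Type} [Field K] (vK : K → ℚ) (n k : ℕ) (h : Polynomial K) : Prop :=
  h.natDegree = n ∧ h.coeff 0 ≠ 0 ∧ vK (h.coeff n) = 0 ∧ vK (h.coeff 0) = (k : ℚ) ∧
    (∀ i, h.coeff i ≠ 0 → 0 ≤ vK (h.coeff i)) ∧
    ∀ i, h.coeff i ≠ 0 → (k : ℚ) ≤ vK (h.coeff i) + (i : ℚ) * k / n

/-- A rational-valued order function on the nonzero elements of a field; its value at `0` is
irrelevant. -/
structure IsOrderFunction {F : Type*} [Field F] (v : F → ℚ) : Prop where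
  map_mul : ∀ x y : F, x ≠ 0 → y ≠ 0 → v (x * y) = v x + v y
  map_add : ∀ x y : F, x ≠ 0 → y ≠ 0 → x + y ≠ 0 → min (v x) (v y) ≤ v (x + y)

/-- `x` has order greater than `c`, where `0` has infinite order. -/
def OrderGT {F : Type*} [Field F] (v : F → ℚ) (c : ℚ) (x : F) : Prop :=
  x = 0 ∨ c < v x

namespace IsOrderFunction

variable {F : Type*} [Field F] {v : F → ℚ} {c d : ℚ} {x y : F}

lemma map_one (hv : IsOrderFunction v) : v 1 = 0 := by
  have := hv.map_mul 1 1 one_ne_zero one_ne_zero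
  rw [mul_one] at this
  linarith

lemma map_neg_one (hv : IsOrderFunction v) : v (-1) = 0 := by
  have := hv.map_mul (-1) (-1) (neg_ne_zero.2 one_ne_zero) (neg_ne_zero.2 one_ne_zero)
  rw [neg_mul_neg, mul_one, hv.map_one] at this
  linarith

lemma map_pow (hv : IsOrderFunction v) (hx : x ≠ 0) (m : ℕ) : v (x ^ m) = m * v x := by
  induction m with
  | zero => simp [hv.map_one]
  | succ m ih =>
    rw [pow_succ, hv.map_mul _ _ (pow_ne_zero _ hx) hx, ih]
    push_cast
    ring

lemma map_div (hv : IsOrderFunction v) (hx : x ≠ 0) (hy : y ≠ 0) : v (x / y) = v x - v y := by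
  have := hv.map_mul (x / y) y (div_ne_zero hx hy) hy
  rw [div_mul_cancel₀ _ hy] at this
  linarith

lemma orderGT_add (hv : IsOrderFunction v) (hx : OrderGT v c x) (hy : OrderGT v c y) :
    OrderGT v c (x + y) := by
  by_cases hx0 : x = 0
  · simpa [hx0] using hy
  by_cases hy0 : y = 0
  · simpa [hy0] using hx
  by_cases hxy : x + y = 0
  · exact Or.inl hxy
  · exact Or.inr ((lt_min (hx.resolve_left hx0) (hy.resolve_left hy0)).trans_le
      (hv.map_add x y hx0 hy0 hxy))

lemma orderGT_sum (hv : IsOrderFunction v) {ι : Type*} (s : Finset ι) (f : ι → F)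
    (hf : ∀ i ∈ s, OrderGT v c (f i)) : OrderGT v c (∑ i ∈ s, f i) :=
  Finset.sum_induction f (OrderGT v c) (fun _ _ => hv.orderGT_add) (Or.inl rfl) hf

lemma orderGT_mul (hv : IsOrderFunction v) (hx : OrderGT v c x) (hy : OrderGT v d y) :
    OrderGT v (c + d) (x * y) := by
  by_cases hx0 : x = 0
  · exact Or.inl (by simp [hx0])
  by_cases hy0 : y = 0
  · exact Or.inl (by simp [hy0])
  refine Or.inr ?_
  rw [hv.map_mul _ _ hx0 hy0]
  exact add_lt_add (hx.resolve_left hx0) (hy.resolve_left hy0)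

lemma orderGT_mul_left (hv : IsOrderFunction v) (hx : OrderGT v c x) (hy : y ≠ 0)
    (hd : v y + c = d) : OrderGT v d (y * x) := by
  by_cases hx0 : x = 0
  · exact Or.inl (by simp [hx0])
  refine Or.inr ?_
  rw [hv.map_mul _ _ hy hx0]
  linarith [hx.resolve_left hx0]

lemma orderGT_neg (hv : IsOrderFunction v) (hx : OrderGT v c x) : OrderGT v c (-x) := by
  rw [← neg_one_mul]
  exact hv.orderGT_mul_left hx (neg_ne_zero.2 one_ne_zero) (by rw [hv.map_neg_one, zero_add])

lemma orderGT_natCast_mul (hv : IsOrderFunction v) (hx : OrderGT v c x) (m : ℕ) :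
    OrderGT v c (m * x) := by
  have := hv.orderGT_sum (range m) (fun _ => x) fun _ _ => hx
  rwa [Finset.sum_const, card_range, nsmul_eq_mul] at this

lemma orderGT_intCast_mul (hv : IsOrderFunction v) (hx : OrderGT v c x) (m : ℤ) :
    OrderGT v c (m * x) := by
  obtain ⟨m, rfl | rfl⟩ := m.eq_nat_or_neg
  · simpa using hv.orderGT_natCast_mul hx m
  · simpa using hv.orderGT_neg (hv.orderGT_natCast_mul hx m)

lemma not_orderGT_one (hv : IsOrderFunction v) : ¬ OrderGT v 0 1 := by
  rintro (h | h)
  · exact one_ne_zero h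
  · exact h.ne' hv.map_one

lemma map_natCast_nonneg (hv : IsOrderFunction v) {m : ℕ} (hm : (m : F) ≠ 0) :
    0 ≤ v (m : F) := by
  by_contra! hneg
  have h1 : OrderGT v (v (m : F)) 1 := Or.inr (by rwa [hv.map_one])
  have := hv.orderGT_natCast_mul h1 m
  rw [mul_one] at this
  exact (this.resolve_left hm).false

lemma map_natCast_of_coprime (hv : IsOrderFunction v) {p m : ℕ} (hp : 0 < v (p : F))
    (hm : (m : F) ≠ 0) (hpm : Nat.Coprime p m) : v (m : F) = 0 := by
  refine le_antisymm ?_ (hv.map_natCast_nonneg hm)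
  by_contra! hpos
  have hbez := Nat.gcd_eq_gcd_ab p m
  rw [hpm] at hbez
  have hbez' : (1 : F) = (Nat.gcdA p m : F) * p + (Nat.gcdB p m : F) * m := by
    have := congrArg (Int.cast : ℤ → F) hbez
    push_cast at this
    rw [this]
    ring
  apply hv.not_orderGT_one
  rw [hbez']
  exact hv.orderGT_add (hv.orderGT_intCast_mul (Or.inr hp) _)
    (hv.orderGT_intCast_mul (Or.inr hpos) _)

lemma one_add_ne_zero (hv : IsOrderFunction v) (hx : OrderGT v 0 x) : 1 + x ≠ 0 := by
  intro h
  apply hv.not_orderGT_one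
  rw [eq_neg_of_add_eq_zero_left h]
  exact hv.orderGT_neg hx

lemma map_one_add (hv : IsOrderFunction v) (hx : OrderGT v 0 x) : v (1 + x) = 0 := by
  have hne := hv.one_add_ne_zero hx
  by_cases hx0 : x = 0
  · simp [hx0, hv.map_one]
  apply le_antisymm
  · by_contra! hpos
    apply hv.not_orderGT_one
    rw [← add_neg_cancel_right 1 x]
    exact hv.orderGT_add (Or.inr hpos) (hv.orderGT_neg hx)
  · have := hv.map_add 1 x one_ne_zero hx0 hne
    rwa [hv.map_one, min_eq_left (hx.resolve_left hx0).le] at this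

lemma orderGT_prod_one_add_sub_one (hv : IsOrderFunction v) {ι : Type*} (s : Finset ι)
    (ε : ι → F) (hε : ∀ i ∈ s, OrderGT v 0 (ε i)) :
    OrderGT v 0 (∏ i ∈ s, (1 + ε i) - 1) := by
  classical
  induction s using Finset.induction_on with
  | empty => exact Or.inl (by simp)
  | insert a s ha ih =>
    have h1 := hε a (Finset.mem_insert_self a s)
    have h2 := ih fun i hi => hε i (Finset.mem_insert_of_mem hi)
    rw [Finset.prod_insert ha, show (1 + ε a) * ∏ i ∈ s, (1 + ε i) - 1 =
      (∏ i ∈ s, (1 + ε i) - 1) + ε a + ε a * (∏ i ∈ s, (1 + ε i) - 1) by ring]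
    refine hv.orderGT_add (hv.orderGT_add h2 h1) ?_
    simpa using hv.orderGT_mul h1 h2

end IsOrderFunction

lemma prod_prod_Ioi_sub_sq {R : Type*} [CommRing R] {n : ℕ} (θ : Fin n → R) :
    ∏ i, ∏ j ∈ Ioi i, (θ i - θ j) ^ 2 =
      (-1) ^ (n * (n - 1) / 2) * ∏ i, ∏ j ∈ univ.erase i, (θ i - θ j) := by
  have hcount : ∏ i : Fin n, ∏ _j ∈ Ioi i, (-1 : R) = (-1) ^ (n * (n - 1) / 2) := by
    simp only [Finset.prod_const, Fin.card_Ioi]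
    rw [Finset.prod_pow_eq_pow_sum, Fin.sum_univ_eq_sum_range (fun i => n - 1 - i) n,
      Finset.sum_range_reflect (fun i => i) n, Finset.sum_range_id]
  have hoff : ∏ i, ∏ j ∈ univ.erase i, (θ i - θ j) =
      ∏ i, ∏ j ∈ Ioi i, (θ j - θ i) * (θ i - θ j) := by
    rw [Finset.prod_prod_Ioi_mul_eq_prod_prod_off_diag (fun i j => θ i - θ j)]
    rw [Finset.prod_comm' (t' := univ) (s' := fun i => univ.erase i) (by simp [eq_comm])]
    refine Finset.prod_congr rfl fun i _ => Finset.prod_congr ?_ fun _ _ => rfl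
    ext j
    simp
  rw [hoff, ← hcount, ← Finset.prod_mul_distrib]
  refine Finset.prod_congr rfl fun i _ => ?_
  rw [← Finset.prod_mul_distrib]
  exact Finset.prod_congr rfl fun j _ => by ring

lemma eval_derivative_C_mul_prod_X_sub_C {R ι : Type*} [CommRing R] [Fintype ι] [DecidableEq ι]
    (a : R) (θ : ι → R) (i : ι) :
    (derivative (C a * ∏ j, (X - C (θ j)))).eval (θ i) =
      a * ∏ j ∈ univ.erase i, (θ i - θ j) := by
  rw [derivative_C_mul, eval_mul, eval_C, derivative_prod_finset, eval_finsetSum,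
    Finset.sum_eq_single i]
  · simp [eval_prod]
  · intro j _ hj
    rw [eval_mul, eval_prod, Finset.prod_eq_zero (Finset.mem_erase.2 ⟨hj.symm, mem_univ i⟩),
      zero_mul]
    simp
  · simp

lemma exists_algebraMap_eq_prod_eval_derivative {K L ι : Type*} [Field K] [Field L] [Algebra K L]
    [Fintype ι] (h : K[X]) (h0 : h ≠ 0) (θ : ι → L)
    (hfac : h.map (algebraMap K L) =
      C (algebraMap K L h.leadingCoeff) * ∏ i, (X - C (θ i))) :
    ∃ r : K, algebraMap K L r = ∏ i, (derivative (h.map (algebraMap K L))).eval (θ i) := by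
  have ha : algebraMap K L h.leadingCoeff ≠ 0 := by simpa using h0
  have hsplits : (h.map (algebraMap K L)).Splits := by
    rw [hfac]
    exact .mul (.C _) (.prod fun i _ => .X_sub_C _)
  have hroots : (h.map (algebraMap K L)).roots = univ.val.map θ := by
    rw [hfac, roots_C_mul _ ha]
    exact (congrArg roots (by rw [Multiset.map_map]; rfl)).trans
      (roots_multiset_prod_X_sub_C (univ.val.map θ))
  have hres := resultant_eq_prod_eval (h.map (algebraMap K L))
    (derivative (h.map (algebraMap K L))) _ le_rfl hsplits
  rw [hroots, leadingCoeff_map, Multiset.map_map, derivative_map, resultant_map_map] at hres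
  refine ⟨resultant h (derivative h) (h.map (algebraMap K L)).natDegree
    ((derivative h).map (algebraMap K L)).natDegree /
      h.leadingCoeff ^ ((derivative h).map (algebraMap K L)).natDegree, ?_⟩
  rw [map_div₀, hres, map_pow, mul_div_cancel_left₀ _ (pow_ne_zero _ ha), derivative_map]
  rfl

/-- A root of a polynomial whose Newton polygon is a single segment from `(0, k)` to `(n, 0)`
has order `k / n`. -/
lemma IsOrderFunction.map_root {F : Type*} [Field F] {v : F → ℚ} (hv : IsOrderFunction v)
    {f : F[X]} {n k : ℕ} (hn : 0 < n) (hdeg : f.natDegree = n) (h0 : f.coeff 0 ≠ 0)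
    (hvn : v (f.coeff n) = 0) (hv0 : v (f.coeff 0) = k)
    (hseg : ∀ i, f.coeff i ≠ 0 → (k : ℚ) ≤ v (f.coeff i) + (i : ℚ) * k / n)
    {θ : F} (hθ : f.eval θ = 0) : θ ≠ 0 ∧ v θ = k / n := by
  have hnQ : (0 : ℚ) < n := by exact_mod_cast hn
  have hθ0 : θ ≠ 0 := by
    rintro rfl
    rw [← coeff_zero_eq_eval_zero] at hθ
    exact h0 hθ
  have han : f.coeff n ≠ 0 := by
    rw [← hdeg, coeff_natDegree, leadingCoeff_ne_zero]
    rintro rfl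
    simp at h0
  refine ⟨hθ0, ?_⟩
  obtain ⟨δ, hδ⟩ : ∃ δ, v θ = k / n + δ := ⟨v θ - k / n, by ring⟩
  have hterm : ∀ i, f.coeff i ≠ 0 → (k : ℚ) + i * δ ≤ v (f.coeff i * θ ^ i) := by
    intro i hi
    rw [hv.map_mul _ _ hi (pow_ne_zero _ hθ0), hv.map_pow hθ0, hδ]
    have := hseg i hi
    rw [mul_div_assoc] at this
    linarith
  have hlead : v (f.coeff n * θ ^ n) = k + n * δ := by
    rw [hv.map_mul _ _ han (pow_ne_zero _ hθ0), hv.map_pow hθ0, hδ, hvn]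
    field_simp
    ring
  rw [eval_eq_sum_range, hdeg] at hθ
  rcases lt_trichotomy δ 0 with hneg | rfl | hpos
  · exfalso
    rw [Finset.sum_range_succ] at hθ
    have hgt : OrderGT v (k + n * δ) (∑ i ∈ range n, f.coeff i * θ ^ i) := by
      refine hv.orderGT_sum _ _ fun i hi => ?_
      by_cases hi0 : f.coeff i = 0
      · exact Or.inl (by simp [hi0])
      · have hin : (i : ℚ) < n := by exact_mod_cast Finset.mem_range.1 hi
        exact Or.inr (lt_of_lt_of_le (by nlinarith) (hterm i hi0))
    have := hv.orderGT_neg hgt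
    rw [← eq_neg_of_add_eq_zero_right hθ] at this
    have := this.resolve_left (mul_ne_zero han (pow_ne_zero _ hθ0))
    linarith
  · rw [hδ, add_zero]
  · exfalso
    rw [Finset.sum_range_succ', pow_zero, mul_one] at hθ
    have hgt : OrderGT v k (∑ i ∈ range n, f.coeff (i + 1) * θ ^ (i + 1)) := by
      refine hv.orderGT_sum _ _ fun i _ => ?_
      by_cases hi0 : f.coeff (i + 1) = 0
      · exact Or.inl (by simp [hi0])
      · refine Or.inr (lt_of_lt_of_le ?_ (hterm (i + 1) hi0))
        push_cast
        nlinarith [(Nat.cast_nonneg i : (0 : ℚ) ≤ i)]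
    have := hv.orderGT_neg hgt
    rw [← eq_neg_of_add_eq_zero_right hθ] at this
    have := this.resolve_left h0
    linarith

lemma intCast_ne_mul_div_of_coprime {k n i : ℕ} (hkn : Nat.gcd k n = 1) (hi0 : 0 < i)
    (hin : i < n) (m : ℤ) : (m : ℚ) ≠ i * k / n := by
  intro h
  have hn : (n : ℚ) ≠ 0 := by exact_mod_cast (hi0.trans hin).ne'
  rw [eq_div_iff hn] at h
  have h' : m * n = i * k := by exact_mod_cast h
  have hdvd : n ∣ i * k := by exact_mod_cast (Dvd.intro_left m h' : (n : ℤ) ∣ i * k)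
  have := (Nat.Coprime.symm hkn).dvd_of_dvd_mul_right hdvd
  exact absurd (Nat.le_of_dvd hi0 this) (not_le.2 hin)

/-- At an element of order `k / n`, the derivative of a polynomial whose Newton polygon meets
lattice points only at its end points is dominated by its leading term. -/
lemma IsOrderFunction.eval_derivative_eq {F : Type*} [Field F] {v : F → ℚ}
    (hv : IsOrderFunction v) {f : F[X]} {n k : ℕ} (hn : 0 < n) (hgcd : Nat.gcd k n = 1)
    (hdeg : f.natDegree = n) (han : f.coeff n ≠ 0) (hvn : v (f.coeff n) = 0)
    (hn0 : (n : F) ≠ 0) (hvn0 : v (n : F) = 0)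
    (hint : ∀ i, f.coeff i ≠ 0 → ∃ m : ℤ, v (f.coeff i) = m)
    (hseg : ∀ i, f.coeff i ≠ 0 → (k : ℚ) ≤ v (f.coeff i) + (i : ℚ) * k / n)
    {θ : F} (hθ0 : θ ≠ 0) (hθ : v θ = k / n) :
    ∃ ε, OrderGT v 0 ε ∧
      (derivative f).eval θ = n * f.coeff n * θ ^ (n - 1) * (1 + ε) := by
  obtain ⟨m, rfl⟩ : ∃ m, n = m + 1 := ⟨n - 1, by omega⟩
  set M : F := ((m + 1 : ℕ) : F) * f.coeff (m + 1) * θ ^ m with hM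
  have hM0 : M ≠ 0 := mul_ne_zero (mul_ne_zero hn0 han) (pow_ne_zero _ hθ0)
  have hvM : v M = m * (k / (m + 1 : ℕ)) := by
    rw [hM, hv.map_mul _ _ (mul_ne_zero hn0 han) (pow_ne_zero _ hθ0), hv.map_mul _ _ hn0 han,
      hvn0, hvn, hv.map_pow hθ0, hθ]
    ring
  set S : F := ∑ i ∈ range m, (derivative f).coeff i * θ ^ i with hS
  have heval : (derivative f).eval θ = S + M := by
    rw [eval_eq_sum_range' (n := m + 1)
      ((natDegree_derivative_lt (by omega)).trans_eq hdeg), Finset.sum_range_succ,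
      coeff_derivative]
    simp only [hS, hM]
    push_cast
    ring
  have hSgt : OrderGT v (v M) S := by
    refine hv.orderGT_sum _ _ fun i hi => ?_
    rw [coeff_derivative, show f.coeff (i + 1) * ((i : F) + 1) * θ ^ i =
      ((i + 1 : ℕ) : F) * (f.coeff (i + 1) * θ ^ i) by push_cast; ring]
    apply hv.orderGT_natCast_mul
    by_cases hi0 : f.coeff (i + 1) = 0
    · exact Or.inl (by simp [hi0])
    refine Or.inr ?_
    rw [hv.map_mul _ _ hi0 (pow_ne_zero _ hθ0), hv.map_pow hθ0, hθ, hvM]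
    obtain ⟨z, hz⟩ := hint (i + 1) hi0
    have hle := hseg (i + 1) hi0
    have hne := intCast_ne_mul_div_of_coprime hgcd (Nat.succ_pos i)
      (Nat.succ_lt_succ (Finset.mem_range.1 hi)) (k - z)
    rw [hz] at hle ⊢
    have hlt : (k : ℚ) < z + (i + 1 : ℕ) * k / (m + 1 : ℕ) := by
      refine lt_of_le_of_ne hle fun h => hne ?_
      push_cast at h ⊢
      linarith
    have hk : (k : ℚ) = (m + 1) * (k / (m + 1 : ℕ)) := by
      push_cast
      field_simp
    rw [mul_div_assoc] at hlt
    push_cast at hlt hk ⊢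
    linarith
  refine ⟨M⁻¹ * S, hv.orderGT_mul_left hSgt (inv_ne_zero hM0) ?_, ?_⟩
  · have := hv.map_div one_ne_zero hM0
    rw [one_div, hv.map_one] at this
    linarith
  · rw [heval, Nat.add_sub_cancel, ← hM, mul_add, mul_one, mul_inv_cancel_left₀ hM0, add_comm]

/-- For a `k`-Eisenstein polynomial `h` of degree `n` with `p ∤ n`, `gcd(k,n)=1`:
the discriminant `Δ = aₙ^{2n-2}∏_{i<j}(θᵢ-θⱼ)²` satisfies `v(Δ) = k(n-1)` and its unit
part `u = p^{-k(n-1)}Δ` satisfies `u ≡ (-1)^{n(n-1)/2} nⁿ aₙ^{n-1} w^{n-1} (mod p)`,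
where `w = p^{-k}a₀`. -/
theorem stmt_6 (p : ℕ) [Fact p.Prime]
    (K Ω : Type) [Field K] [Algebra ℚ_[p] K] [FiniteDimensional ℚ_[p] K]
    [Field Ω] [Algebra K Ω] [IsAlgClosed Ω] [Algebra.IsAlgebraic K Ω]
    (v : Ω → ℚ)
    (hmul : ∀ x y : Ω, x ≠ 0 → y ≠ 0 → v (x * y) = v x + v y)
    (hadd : ∀ x y : Ω, x ≠ 0 → y ≠ 0 → x + y ≠ 0 → min (v x) (v y) ≤ v (x + y))
    (hvp : v ((p : Ω)) = 1)
    (hur : ∀ x : K, x ≠ 0 → ∃ m : ℤ, v (algebraMap K Ω x) = (m : ℚ))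
    (n k : ℕ) (hpn : ¬ p ∣ n) (hk1 : 1 ≤ k) (hkn : k < n) (hgcd : Nat.gcd k n = 1)
    (h : Polynomial K) (hEis : IsKEisenstein (fun x => v (algebraMap K Ω x)) n k h)
    (θs : Fin n → Ω)
    (hfac : h.map (algebraMap K Ω) =
      C (algebraMap K Ω (h.coeff n)) * ∏ i, (X - C (θs i)))
    (Δ : Ω)
    (hΔ : Δ = (algebraMap K Ω (h.coeff n)) ^ (2 * n - 2) *
      ∏ i, ∏ j ∈ Ioi i, (θs i - θs j) ^ 2) :
    Δ ≠ 0 ∧ v Δ = (k : ℚ) * ((n : ℚ) - 1) ∧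
      (Δ / (p : Ω) ^ (k * (n - 1)) -
          (-1) ^ (n * (n - 1) / 2) * (n : Ω) ^ n * (algebraMap K Ω (h.coeff n)) ^ (n - 1) *
            (algebraMap K Ω (h.coeff 0) / (p : Ω) ^ k) ^ (n - 1) = 0 ∨
        1 ≤ v (Δ / (p : Ω) ^ (k * (n - 1)) -
          (-1) ^ (n * (n - 1) / 2) * (n : Ω) ^ n * (algebraMap K Ω (h.coeff n)) ^ (n - 1) *
            (algebraMap K Ω (h.coeff 0) / (p : Ω) ^ k) ^ (n - 1))) := by
  have hv : IsOrderFunction v := ⟨hmul, hadd⟩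
  obtain ⟨hdeg, h0, hvn, hv0, -, hseg⟩ := hEis
  have hn : 0 < n := by omega
  have hinj := (algebraMap K Ω).injective
  have : CharZero K := charZero_of_injective_algebraMap (algebraMap ℚ_[p] K).injective
  have : CharZero Ω := charZero_of_injective_algebraMap hinj
  have hp0 : (p : Ω) ≠ 0 := Nat.cast_ne_zero.2 (Fact.out : p.Prime).ne_zero
  have hn0 : (n : Ω) ≠ 0 := Nat.cast_ne_zero.2 hn.ne'
  have hvn0 : v (n : Ω) = 0 := hv.map_natCast_of_coprime (hvp ▸ one_pos) hn0
    ((Nat.Prime.coprime_iff_not_dvd Fact.out).2 hpn)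
  have hh0 : h ≠ 0 := by
    rintro rfl
    simp at h0
  have hlc : h.coeff n = h.leadingCoeff := by rw [← hdeg, coeff_natDegree]
  set a := algebraMap K Ω (h.coeff n) with ha
  set b := algebraMap K Ω (h.coeff 0) with hb
  have ha0 : a ≠ 0 := by
    rw [ha, hlc]
    simpa using hh0
  have hb0 : b ≠ 0 := by simpa [hb] using h0
  have hcoeff : ∀ i, (h.map (algebraMap K Ω)).coeff i ≠ 0 → h.coeff i ≠ 0 := by
    intro i hi hi0
    rw [coeff_map, hi0, map_zero] at hi
    exact hi rfl
  have hsegΩ : ∀ i, (h.map (algebraMap K Ω)).coeff i ≠ 0 →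
      (k : ℚ) ≤ v ((h.map (algebraMap K Ω)).coeff i) + (i : ℚ) * k / n := fun i hi => by
    rw [coeff_map]
    exact hseg i (hcoeff i hi)
  have hroot : ∀ i, θs i ≠ 0 ∧ v (θs i) = k / n := fun i => by
    refine hv.map_root (f := h.map (algebraMap K Ω)) hn (by simpa using hdeg)
      (by rwa [coeff_map]) (by rwa [coeff_map]) (by rwa [coeff_map]) hsegΩ ?_
    rw [hfac, eval_mul, eval_prod, Finset.prod_eq_zero (mem_univ i) (by simp), mul_zero]
  have hder : ∀ i, ∃ ε, OrderGT v 0 ε ∧ (derivative (h.map (algebraMap K Ω))).eval (θs i) =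
      n * a * θs i ^ (n - 1) * (1 + ε) := fun i => by
    rw [ha, ← coeff_map]
    refine hv.eval_derivative_eq (f := h.map (algebraMap K Ω)) hn hgcd (by simpa using hdeg)
      (by rwa [coeff_map]) (by rwa [coeff_map]) hn0 hvn0 (fun i hi => ?_) hsegΩ
      (hroot i).1 (hroot i).2
    rw [coeff_map]
    exact hur _ (hcoeff i hi)
  choose ε hε hderε using hder
  set P := ∏ i, ∏ j ∈ univ.erase i, (θs i - θs j) with hP
  have hprod : ∏ i, (derivative (h.map (algebraMap K Ω))).eval (θs i) = a ^ n * P := by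
    simp_rw [hfac, eval_derivative_C_mul_prod_X_sub_C]
    rw [Finset.prod_mul_distrib, Finset.prod_const, card_univ, Fintype.card_fin]
  have hΔP : Δ = (-1) ^ (n * (n - 1) / 2) * a ^ (n - 2) * (a ^ n * P) := by
    rw [hΔ, prod_prod_Ioi_sub_sq, show 2 * n - 2 = n - 2 + n by omega]
    ring
  have hconst : b = a * ((-1) ^ n * ∏ i, θs i) := by
    have := congrArg (fun q => coeff q 0) hfac
    simp only [coeff_map, coeff_C_mul, coeff_zero_prod, coeff_sub, coeff_X_zero, coeff_C_zero,
      zero_sub, Finset.prod_neg, card_univ, Fintype.card_fin] at this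
    exact this
  set E := ∏ i, (1 + ε i) with hE
  have hEgt : OrderGT v 0 (E - 1) := hv.orderGT_prod_one_add_sub_one _ _ fun i _ => hε i
  have hE0 : E ≠ 0 := by simpa using hv.one_add_ne_zero hEgt
  have hvE : v E = 0 := by simpa using hv.map_one_add hEgt
  have hsign : ((-1 : Ω) ^ n) ^ (n - 1) = 1 := by
    rw [← pow_mul]
    exact (Nat.even_mul_pred_self n).neg_one_pow
  set M := (-1) ^ (n * (n - 1) / 2) * (n : Ω) ^ n * a ^ (n - 1) * (b / (p : Ω) ^ k) ^ (n - 1)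
    with hM
  set q := (p : Ω) ^ (k * (n - 1)) with hq
  have hq0 : q ≠ 0 := pow_ne_zero _ hp0
  have hΔM : Δ = M * q * E := by
    have hMq : M * q = (-1) ^ (n * (n - 1) / 2) * (n : Ω) ^ n * a ^ (n - 1) * b ^ (n - 1) := by
      rw [hM, hq, pow_mul, mul_assoc, ← mul_pow, div_mul_cancel₀ _ (pow_ne_zero _ hp0)]
    rw [hMq, hΔP, ← hprod, Finset.prod_congr rfl fun i _ => hderε i, hconst]
    simp only [Finset.prod_mul_distrib, Finset.prod_const, card_univ, Fintype.card_fin,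
      Finset.prod_pow, mul_pow, hsign]
    obtain ⟨m, rfl⟩ : ∃ m, n = m + 2 := ⟨n - 2, by omega⟩
    simp only [Nat.add_sub_cancel, show m + 2 - 1 = m + 1 by omega]
    ring
  have hneg : ((-1 : Ω) ^ (n * (n - 1) / 2)) ≠ 0 := pow_ne_zero _ (neg_ne_zero.2 one_ne_zero)
  have hw0 : b / (p : Ω) ^ k ≠ 0 := div_ne_zero hb0 (pow_ne_zero _ hp0)
  have hvw : v (b / (p : Ω) ^ k) = 0 := by
    rw [hv.map_div hb0 (pow_ne_zero _ hp0), hv.map_pow hp0, hvp, mul_one]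
    exact sub_eq_zero.2 hv0
  have hM0 : M ≠ 0 := mul_ne_zero (mul_ne_zero (mul_ne_zero hneg (pow_ne_zero _ hn0))
    (pow_ne_zero _ ha0)) (pow_ne_zero _ hw0)
  have hvM : v M = 0 := by
    rw [hM, hv.map_mul _ _ (mul_ne_zero (mul_ne_zero hneg (pow_ne_zero _ hn0))
        (pow_ne_zero _ ha0)) (pow_ne_zero _ hw0),
      hv.map_mul _ _ (mul_ne_zero hneg (pow_ne_zero _ hn0)) (pow_ne_zero _ ha0),
      hv.map_mul _ _ hneg (pow_ne_zero _ hn0), hv.map_pow (neg_ne_zero.2 one_ne_zero),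
      hv.map_pow hn0, hv.map_pow ha0, hv.map_pow hw0, hv.map_neg_one, hvn0, hvw,
      show v a = 0 from hvn]
    ring
  refine ⟨?_, ?_, ?_⟩
  · rw [hΔM]
    exact mul_ne_zero (mul_ne_zero hM0 hq0) hE0
  · rw [hΔM, hv.map_mul _ _ (mul_ne_zero hM0 hq0) hE0, hv.map_mul _ _ hM0 hq0, hvM, hvE, hq,
      hv.map_pow hp0, hvp, Nat.cast_mul, Nat.cast_pred hn]
    ring
  · obtain ⟨r, hr⟩ := exists_algebraMap_eq_prod_eval_derivative h hh0 θs (by rw [hfac, ha, hlc])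
    obtain ⟨d, hd⟩ : ∃ d : K, algebraMap K Ω d = Δ / q - M := by
      refine ⟨(-1) ^ (n * (n - 1) / 2) * h.coeff n ^ (n - 2) * r / (p : K) ^ (k * (n - 1)) -
        (-1) ^ (n * (n - 1) / 2) * (n : K) ^ n * h.coeff n ^ (n - 1) *
          (h.coeff 0 / (p : K) ^ k) ^ (n - 1), ?_⟩
      rw [hΔP, ← hprod, ← hr]
      simp [hM, hq, ha, hb]
    have hgt : OrderGT v 0 (Δ / q - M) := by
      rw [hΔM, show M * q * E / q - M = M * (E - 1) by field_simp]
      exact hv.orderGT_mul_left hEgt hM0 (by rw [hvM, zero_add])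
    rw [← hd] at hgt ⊢
    refine (eq_or_ne d 0).imp (fun hd0 => by rw [hd0, map_zero]) fun hd0 => ?_
    have hpos := hgt.resolve_left ((_root_.map_ne_zero _).2 hd0)
    obtain ⟨z, hz⟩ := hur d hd0
    rw [hz] at hpos ⊢
    exact_mod_cast hpos
end

section
/- Let $q$ be a prime, $K$ a finite unramified extension of $\mathbb{Q}_p$ with $p \ne q$, $f \in \mathcal{O}_K[x]$ an irreducible polynomial of degree $q$ with root $\theta$. If $K(\theta)/K$ is unramified, then $q(q-1)$ divides $v(\Delta_f)$, where $\Delta_f$ is the discriminant of $f$. -/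
open Polynomial Finset

theorem PadicInt.exists_pow_eq_of_isUnit {p : ℕ} [Fact p.Prime] {u : ℤ_[p]} (hu : IsUnit u)
    (k : ℕ) : ∃ y : ℤ_[p], y ^ (p * k * (p - 1) + 1) = u := by
  set n := p * k * (p - 1) + 1 with hn
  have hun : ‖u‖ = 1 := PadicInt.isUnit_iff.1 hu
  have hcop : IsUnit (n : ℤ_[p]) := by
    rw [PadicInt.isUnit_iff]
    refine le_antisymm (PadicInt.norm_le_one _) (not_lt.1 fun h ↦ ?_)
    have h1 : ‖((n : ℤ) : ℤ_[p])‖ < 1 := by exact_mod_cast h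
    rw [PadicInt.norm_int_lt_one_iff_dvd, Int.natCast_dvd_natCast, hn,
      Nat.dvd_add_right ⟨k * (p - 1), by ring⟩, Nat.dvd_one] at h1
    exact (Fact.out : p.Prime).one_lt.ne' h1
  have hder : ‖(derivative (X ^ n - C u : ℤ_[p][X])).aeval u‖ = 1 := by
    simp [derivative_X_pow, PadicInt.isUnit_iff.1 hcop, hun]
  have hval : ‖(X ^ n - C u : ℤ_[p][X]).aeval u‖ < 1 := by
    have hz : PadicInt.toZMod u ≠ 0 := (hu.map PadicInt.toZMod).ne_zero
    have : PadicInt.toZMod (u ^ n - u) = 0 := by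
      rw [map_sub, map_pow, hn, pow_succ, mul_comm _ (p - 1), pow_mul, ZMod.pow_card_sub_one_eq_one hz]
      simp
    rw [← RingHom.mem_ker, PadicInt.ker_toZMod, IsLocalRing.mem_maximalIdeal,
      PadicInt.mem_nonunits] at this
    simpa using this
  obtain ⟨z, hz, -⟩ := hensels_lemma (F := (X ^ n - C u : ℤ_[p][X])) (a := u)
    (by rw [hder]; simpa using hval)
  exact ⟨z, by simpa [sub_eq_zero] using hz⟩

/-- A `ℚ`-valued valuation, with no condition on its value at `0`. -/
structure IsRatValuation {L : Type*} [Field L] (v : L → ℚ) : Prop where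
  map_mul : ∀ x y : L, x ≠ 0 → y ≠ 0 → v (x * y) = v x + v y
  min_le_add : ∀ x y : L, x ≠ 0 → y ≠ 0 → x + y ≠ 0 → min (v x) (v y) ≤ v (x + y)

namespace IsRatValuation

variable {L : Type*} [Field L] {v : L → ℚ} (hv : IsRatValuation v)
include hv

theorem map_one : v 1 = 0 := by
  simpa using hv.map_mul 1 1 one_ne_zero one_ne_zero

theorem map_neg (x : L) : v (-x) = v x := by
  obtain rfl | hx := eq_or_ne x 0
  · simp
  have h := hv.map_mul (-1) (-1) (by simp) (by simp)
  have h' := hv.map_mul (-1) x (by simp) hx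
  have := hv.map_one
  simp only [neg_mul, mul_neg, neg_neg, one_mul] at h h'
  linarith

theorem map_prod {ι : Type*} (s : Finset ι) (g : ι → L) (hg : ∀ i ∈ s, g i ≠ 0) :
    v (∏ i ∈ s, g i) = ∑ i ∈ s, v (g i) := by
  classical
  induction s using Finset.induction_on with
  | empty => simpa using hv.map_one
  | insert a s ha ih =>
    have hs : ∀ i ∈ s, g i ≠ 0 := fun i hi ↦ hg i (mem_insert_of_mem hi)
    rw [prod_insert ha, sum_insert ha, hv.map_mul _ _ (hg a (mem_insert_self a s))
      (prod_ne_zero_iff.2 hs), ih hs]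

theorem map_pow {x : L} (hx : x ≠ 0) (n : ℕ) : v (x ^ n) = n * v x := by
  have := hv.map_prod (range n) (fun _ ↦ x) (fun _ _ ↦ hx)
  simpa using this

theorem map_inv {x : L} (hx : x ≠ 0) : v x⁻¹ = -v x := by
  have := hv.map_mul x x⁻¹ hx (inv_ne_zero hx)
  rw [mul_inv_cancel₀ hx, hv.map_one] at this
  linarith

theorem map_zpow {x : L} (hx : x ≠ 0) (n : ℤ) : v (x ^ n) = n * v x := by
  cases n with
  | ofNat n => simpa using hv.map_pow hx n
  | negSucc n =>
    rw [zpow_negSucc, hv.map_inv (pow_ne_zero _ hx), hv.map_pow hx]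
    push_cast
    ring

/-- The elements of valuation greater than `c`, together with `0`. -/
def ball (c : ℚ) : AddSubgroup L where
  carrier := {x | x ≠ 0 → c < v x}
  zero_mem' := by simp
  neg_mem' {x} hx := by
    intro h
    rw [hv.map_neg]
    exact hx (by simpa using h)
  add_mem' {x y} hx hy := by
    intro h
    by_cases hx0 : x = 0
    · subst hx0; rw [zero_add] at h ⊢; exact hy h
    by_cases hy0 : y = 0
    · subst hy0; rw [add_zero] at h ⊢; exact hx h
    exact (lt_min (hx hx0) (hy hy0)).trans_le (hv.min_le_add x y hx0 hy0 h)

omit hv in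
theorem map_padicInt_unit {p : ℕ} [Fact p.Prime] {w : ℚ_[p] → ℚ} (hw : IsRatValuation w)
    (hint : ∀ x, x ≠ 0 → ∃ m : ℤ, w x = m) {u : ℤ_[p]} (hu : IsUnit u) : w u = 0 := by
  have hu0 : (u : ℚ_[p]) ≠ 0 := by simpa using hu.ne_zero
  obtain ⟨m, hm⟩ := hint u hu0
  obtain ⟨y, hy⟩ := PadicInt.exists_pow_eq_of_isUnit hu m.natAbs
  set n := p * m.natAbs * (p - 1) + 1 with hn
  have hy0 : (y : ℚ_[p]) ≠ 0 := by
    rintro h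
    have : y = 0 := by simpa using h
    simp [this, hn] at hy
    exact hu.ne_zero hy.symm
  obtain ⟨l, hl⟩ := hint y hy0
  have h := hw.map_pow hy0 n
  rw [← PadicInt.coe_pow, hy, hm, hl] at h
  have h' : m = n * l := by exact_mod_cast h
  have hlt : m.natAbs < n := by
    have hp := (Fact.out : p.Prime).two_le
    have : 1 ≤ p * (p - 1) := Nat.mul_pos (by omega) (by omega)
    have := Nat.mul_le_mul_left m.natAbs this
    rw [hn]
    nlinarith
  have : m = 0 := Int.eq_zero_of_abs_lt_dvd ⟨l, h'⟩ (by rw [Int.abs_eq_natAbs]; exact_mod_cast hlt)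
  simp [hm, this]

omit hv in
theorem eq_padic_valuation {p : ℕ} [Fact p.Prime] {w : ℚ_[p] → ℚ} (hw : IsRatValuation w)
    (hint : ∀ x, x ≠ 0 → ∃ m : ℤ, w x = m) (hp : w p = 1) {x : ℚ_[p]} (hx : x ≠ 0) :
    w x = x.valuation := by
  have hp0 : (p : ℚ_[p]) ≠ 0 := by exact_mod_cast (Fact.out : p.Prime).ne_zero
  have hnorm : ‖x * (p : ℚ_[p]) ^ (-x.valuation)‖ = 1 := by
    rw [norm_mul, Padic.norm_eq_zpow_neg_valuation hx, Padic.norm_p_zpow, ← zpow_add₀]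
    · simp
    · exact_mod_cast (Fact.out : p.Prime).ne_zero
  have hu := hw.map_padicInt_unit hint (u := ⟨_, hnorm.le⟩) (PadicInt.isUnit_iff.2 hnorm)
  change w (x * (p : ℚ_[p]) ^ (-x.valuation)) = 0 at hu
  rw [hw.map_mul _ _ hx (zpow_ne_zero _ hp0), hw.map_zpow hp0, hp] at hu
  push_cast at hu
  linarith

/-- The absolute value `p ^ (-v x)`. -/
noncomputable def absFun {L : Type*} [Field L] (p : ℕ) (v : L → ℚ) (x : L) : ℝ :=
  open Classical in if x = 0 then 0 else (p : ℝ) ^ (-(v x : ℝ))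

omit hv in
theorem absFun_of_ne_zero (p : ℕ) (v : L → ℚ) {x : L} (hx : x ≠ 0) :
    absFun p v x = (p : ℝ) ^ (-(v x : ℝ)) := if_neg hx

omit hv in
theorem absFun_zero (p : ℕ) (v : L → ℚ) : absFun p v 0 = 0 := if_pos rfl

omit hv in
theorem absFun_pos {p : ℕ} [Fact p.Prime] (v : L → ℚ) {x : L} (hx : x ≠ 0) :
    0 < absFun p v x := by
  rw [absFun_of_ne_zero p v hx]
  exact Real.rpow_pos_of_pos (by exact_mod_cast (Fact.out : p.Prime).pos) _

omit hv in
theorem absFun_nonneg {p : ℕ} [Fact p.Prime] (v : L → ℚ) (x : L) : 0 ≤ absFun p v x := by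
  obtain rfl | hx := eq_or_ne x 0
  · exact (absFun_zero p v).ge
  · exact (absFun_pos v hx).le

theorem absFun_mul {p : ℕ} [Fact p.Prime] (x y : L) :
    absFun p v (x * y) = absFun p v x * absFun p v y := by
  obtain rfl | hx := eq_or_ne x 0
  · simp [absFun_zero]
  obtain rfl | hy := eq_or_ne y 0
  · simp [absFun_zero]
  rw [absFun_of_ne_zero p v hx, absFun_of_ne_zero p v hy, absFun_of_ne_zero p v (mul_ne_zero hx hy),
    ← Real.rpow_add (by exact_mod_cast (Fact.out : p.Prime).pos), hv.map_mul x y hx hy]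
  push_cast
  ring_nf

theorem absFun_add {p : ℕ} [Fact p.Prime] (x y : L) :
    absFun p v (x + y) ≤ absFun p v x + absFun p v y := by
  obtain rfl | hx := eq_or_ne x 0
  · simp [absFun_zero]
  obtain rfl | hy := eq_or_ne y 0
  · simp [absFun_zero]
  by_cases hxy : x + y = 0
  · rw [hxy, absFun_zero]
    exact add_nonneg (absFun_nonneg v x) (absFun_nonneg v y)
  have h1 : (1 : ℝ) ≤ p := by exact_mod_cast (Fact.out : p.Prime).one_lt.le
  have h := hv.min_le_add x y hx hy hxy
  have hx' := absFun_nonneg (p := p) v x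
  have hy' := absFun_nonneg (p := p) v y
  obtain h | h := min_le_iff.1 h
  · refine le_trans ?_ (le_add_of_nonneg_right hy')
    rw [absFun_of_ne_zero p v hx, absFun_of_ne_zero p v hxy]
    exact Real.rpow_le_rpow_of_exponent_le h1 (neg_le_neg (by exact_mod_cast h))
  · refine le_trans ?_ (le_add_of_nonneg_left hx')
    rw [absFun_of_ne_zero p v hy, absFun_of_ne_zero p v hxy]
    exact Real.rpow_le_rpow_of_exponent_le h1 (neg_le_neg (by exact_mod_cast h))

/-- A valuation on an extension of `ℚ_[p]` extending the `p`-adic one, as an algebra norm. -/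
noncomputable def algebraNorm {p : ℕ} [Fact p.Prime] [Algebra ℚ_[p] L]
    (hext : ∀ x : ℚ_[p], x ≠ 0 → v (algebraMap ℚ_[p] L x) = x.valuation) :
    AlgebraNorm ℚ_[p] L where
  toFun := absFun p v
  map_zero' := absFun_zero p v
  add_le' := hv.absFun_add
  neg' x := by
    obtain rfl | hx := eq_or_ne x 0
    · simp
    rw [absFun_of_ne_zero p v hx, absFun_of_ne_zero p v (neg_ne_zero.2 hx), hv.map_neg]
  mul_le' x y := (hv.absFun_mul x y).le
  eq_zero_of_map_eq_zero' x h := by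
    by_contra hx
    exact (absFun_pos v hx).ne' h
  smul' a x := by
    rw [Algebra.smul_def, hv.absFun_mul]
    congr 1
    obtain rfl | ha := eq_or_ne a 0
    · simp [absFun_zero]
    rw [absFun_of_ne_zero p v (by simpa using ha), hext a ha, Padic.norm_eq_zpow_neg_valuation ha,
      ← Real.rpow_intCast]
    push_cast
    rfl

theorem map_algEquiv {p : ℕ} [Fact p.Prime] [Algebra ℚ_[p] L] [Algebra.IsAlgebraic ℚ_[p] L]
    (hext : ∀ x : ℚ_[p], x ≠ 0 → v (algebraMap ℚ_[p] L x) = x.valuation)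
    (σ : L ≃ₐ[ℚ_[p]] L) (x : L) : v (σ x) = v x := by
  obtain rfl | hx := eq_or_ne x 0
  · simp
  have hpm : IsPowMul (hv.algebraNorm hext) := by
    intro a n hn
    change absFun p v (a ^ n) = absFun p v a ^ n
    clear hn
    induction n with
    | zero =>
      rw [pow_zero, pow_zero, absFun_of_ne_zero p v one_ne_zero, hv.map_one]
      simp
    | succ n ih => rw [pow_succ, hv.absFun_mul, ih, pow_succ]
  have huniq (y : L) : absFun p v y = spectralNorm ℚ_[p] L y :=
    DFunLike.congr_fun (spectralNorm_unique hpm) y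
  have h : absFun p v (σ x) = absFun p v x := by
    rw [huniq, huniq, ← spectralNorm_eq_of_equiv]
  have hσx : σ x ≠ 0 := by simpa using hx
  rw [absFun_of_ne_zero p v hx, absFun_of_ne_zero p v hσx] at h
  have hp : (1 : ℝ) < p := by exact_mod_cast (Fact.out : p.Prime).one_lt
  have := (Real.strictMono_rpow_of_base_gt_one hp).injective h
  exact_mod_cast neg_injective this

end IsRatValuation

theorem sub_mem_of_prime_natDegree {K Ω : Type*} [Field K] [CharZero K] [Field Ω] [Algebra K Ω]
    [IsAlgClosed Ω] [Algebra.IsAlgebraic K Ω] {f : K[X]} (hirr : Irreducible f)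
    (hdeg : f.natDegree.Prime) (H : AddSubgroup Ω) (hH : ∀ (σ : Ω ≃ₐ[K] Ω), ∀ x ∈ H, σ x ∈ H)
    {a b : Ω} (ha : a ∈ f.rootSet Ω) (hb : b ∈ f.rootSet Ω) (hab : a ≠ b) (habH : a - b ∈ H)
    {x : Ω} (hx : x ∈ f.rootSet Ω) : a - x ∈ H := by
  have hs : (f.map (algebraMap K Ω)).Splits := IsAlgClosed.splits _
  have : Fact (f.map (algebraMap K Ω)).Splits := ⟨hs⟩
  have : Normal K Ω := normal_iff.2 fun y ↦
    ⟨Algebra.IsIntegral.isIntegral y, IsAlgClosed.splits _⟩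
  have := Gal.galAction_isPretransitive f Ω hirr
  have hcard : (Nat.card (f.rootSet Ω)).Prime := by
    rw [Nat.card_eq_fintype_card, card_rootSet_eq_natDegree hirr.separable hs]
    exact hdeg
  have : MulAction.IsPreprimitive f.Gal (f.rootSet Ω) :=
    MulAction.IsPreprimitive.of_prime_card hcard
  have hsmul (g : f.Gal) (y z : f.rootSet Ω) (h : (y : Ω) - z ∈ H) :
      ((g • y : f.rootSet Ω) : Ω) - (g • z : f.rootSet Ω) ∈ H := by
    obtain ⟨σ, rfl⟩ := Gal.restrict_surjective f Ω g
    rw [Gal.restrict_smul, Gal.restrict_smul, ← map_sub]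
    exact hH σ _ h
  let B : Set (f.rootSet Ω) := {y | a - y ∈ H}
  have hB : MulAction.IsBlock f.Gal B := by
    rw [MulAction.isBlock_iff_smul_eq_of_nonempty]
    rintro g ⟨y, ⟨z, hz, rfl⟩, hy⟩
    have hgz : a - (g • z : f.rootSet Ω) ∈ H := hy
    have hz' : a - z ∈ H := hz
    ext w
    rw [Set.mem_smul_set_iff_inv_smul_mem]
    constructor
    · intro hw
      have hw' : a - (g⁻¹ • w : f.rootSet Ω) ∈ H := hw
      have h := H.sub_mem hw' hz'
      rw [sub_sub_sub_cancel_left] at h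
      have h' := hsmul g _ _ h
      rw [smul_inv_smul] at h'
      have := H.add_mem hgz h'
      change a - w ∈ H
      simpa using this
    · intro hw
      have hw' : a - (w : Ω) ∈ H := hw
      have h := H.sub_mem hw' hgz
      rw [sub_sub_sub_cancel_left] at h
      have h' := hsmul g⁻¹ _ _ h
      rw [inv_smul_smul] at h'
      have := H.add_mem hz' h'
      change a - (g⁻¹ • w : f.rootSet Ω) ∈ H
      simpa using this
  obtain h | h := MulAction.IsPreprimitive.isTrivialBlock_of_isBlock hB
  · refine absurd (congrArg Subtype.val (@h ⟨a, ha⟩ ?_ ⟨b, hb⟩ habH)) hab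
    change a - a ∈ H
    simp
  · exact (h ▸ Set.mem_univ _ : (⟨x, hx⟩ : f.rootSet Ω) ∈ B)

theorem two_mul_sum_card_Ioi (q : ℕ) : 2 * ∑ i : Fin q, #(Ioi i) = q * (q - 1) := by
  simp only [Fin.card_Ioi]
  rw [Fin.sum_univ_eq_sum_range (fun i ↦ q - 1 - i), sum_range_reflect (fun i ↦ i), mul_comm,
    sum_range_id_mul_two]

/-- If `f ∈ 𝒪_K[x]` is irreducible of prime degree `q ≠ p` with root `θ`, and `K(θ)/K`
is unramified, then `q(q-1) ∣ v(Δ_f)`, where `Δ_f = ∏_{i<j}(θᵢ-θⱼ)²`. -/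
theorem stmt_7 (p : ℕ) [Fact p.Prime]
    (K Ω : Type) [Field K] [Algebra ℚ_[p] K] [FiniteDimensional ℚ_[p] K]
    [Field Ω] [Algebra K Ω] [IsAlgClosed Ω] [Algebra.IsAlgebraic K Ω]
    (v : Ω → ℚ)
    (hmul : ∀ x y : Ω, x ≠ 0 → y ≠ 0 → v (x * y) = v x + v y)
    (hadd : ∀ x y : Ω, x ≠ 0 → y ≠ 0 → x + y ≠ 0 → min (v x) (v y) ≤ v (x + y))
    (hvp : v ((p : Ω)) = 1)
    (hur : ∀ x : K, x ≠ 0 → ∃ m : ℤ, v (algebraMap K Ω x) = (m : ℚ))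
    (q : ℕ) (hq : q.Prime) (hqp : q ≠ p)
    (f : Polynomial K) (hdeg : f.natDegree = q) (hirr : Irreducible f)
    (hint : ∀ i, f.coeff i ≠ 0 → 0 ≤ v (algebraMap K Ω (f.coeff i)))
    (θs : Fin q → Ω)
    (hfac : f.map (algebraMap K Ω) =
      C (algebraMap K Ω f.leadingCoeff) * ∏ i, (X - C (θs i)))
    (hunram : ∀ x : Ω, x ∈ IntermediateField.adjoin K {θs ⟨0, hq.pos⟩} → x ≠ 0 →
      ∃ m : ℤ, v x = (m : ℚ))
    (Δ : Ω) (hΔ : Δ = ∏ i, ∏ j ∈ Ioi i, (θs i - θs j) ^ 2) :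
    ∃ m : ℤ, v Δ = ((q * (q - 1) : ℕ) : ℚ) * m := by
  have hv : IsRatValuation v := ⟨hmul, hadd⟩
  let : Algebra ℚ_[p] Ω := ((algebraMap K Ω).comp (algebraMap ℚ_[p] K)).toAlgebra
  have : IsScalarTower ℚ_[p] K Ω := IsScalarTower.of_algebraMap_eq fun _ ↦ rfl
  have : Algebra.IsAlgebraic ℚ_[p] Ω := Algebra.IsAlgebraic.trans ℚ_[p] K Ω
  have : CharZero K := charZero_of_injective_algebraMap (algebraMap ℚ_[p] K).injective
  have : CharZero Ω := charZero_of_injective_algebraMap (algebraMap K Ω).injective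
  have hw : IsRatValuation fun x : ℚ_[p] ↦ v (algebraMap ℚ_[p] Ω x) :=
    ⟨fun x y hx hy ↦ by
      rw [map_mul]; exact hmul _ _ (by simpa using hx) (by simpa using hy),
    fun x y hx hy hxy ↦ by
      rw [map_add]
      exact hadd _ _ (by simpa using hx) (by simpa using hy)
        (by rw [← map_add, Ne, map_eq_zero]; exact hxy)⟩
  have hwint (x : ℚ_[p]) (hx : x ≠ 0) : ∃ m : ℤ, v (algebraMap ℚ_[p] Ω x) = m :=
    hur (algebraMap ℚ_[p] K x) (by simpa using hx)
  have hext (x : ℚ_[p]) (hx : x ≠ 0) : v (algebraMap ℚ_[p] Ω x) = x.valuation :=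
    hw.eq_padic_valuation hwint (by simpa using hvp) hx
  have hinv (σ : Ω ≃ₐ[K] Ω) (x : Ω) : v (σ x) = v x :=
    hv.map_algEquiv hext (σ.restrictScalars ℚ_[p]) x
  have : Fact q.Prime := ⟨hq⟩
  have hq0 : (q : Ω) ≠ 0 := by exact_mod_cast hq.ne_zero
  have hvq : v (q : Ω) = 0 := by
    have h := hext q (by exact_mod_cast hq.ne_zero)
    rw [map_natCast, Padic.valuation_natCast, padicValNat_primes (Ne.symm hqp)] at h
    simpa using h
  have hf0 : f.leadingCoeff ≠ 0 := leadingCoeff_ne_zero.2 hirr.ne_zero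
  have hlc : algebraMap K Ω f.leadingCoeff ≠ 0 := by simpa using hf0
  have hroots : (f.map (algebraMap K Ω)).roots = univ.val.map θs := by
    rw [hfac, roots_C_mul _ hlc]
    have h := roots_multiset_prod_X_sub_C (univ.val.map θs)
    rwa [Multiset.map_map] at h
  have hinj : Function.Injective θs := by
    have := nodup_roots (hirr.separable.map (f := algebraMap K Ω))
    rw [hroots] at this
    exact fun i j hij ↦ Multiset.inj_on_of_nodup_map this i (by simp) j (by simp) hij
  have hmem (x : Ω) : x ∈ f.rootSet Ω ↔ ∃ i, θs i = x := by
    rw [rootSet, aroots, hroots]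
    simp
  have hconj (i j : Fin q) : ∃ σ : Ω ≃ₐ[K] Ω, σ (θs i) = θs j := by
    have : Normal K Ω := normal_iff.2 fun y ↦
      ⟨Algebra.IsIntegral.isIntegral y, IsAlgClosed.splits _⟩
    have hmin (k : Fin q) := minpoly.eq_of_irreducible hirr (mem_rootSet.1 ((hmem _).2 ⟨k, rfl⟩)).2
    exact Normal.minpoly_eq_iff_mem_orbit Ω |>.1 ((hmin j).symm.trans (hmin i))
  obtain ⟨s, hs⟩ : ∃ s : K, algebraMap K Ω s = ∑ i, θs i := by
    have h := congrArg nextCoeff hfac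
    rw [nextCoeff_map_eq, nextCoeff_C_mul, prod_X_sub_C_nextCoeff] at h
    refine ⟨-(f.nextCoeff / f.leadingCoeff), ?_⟩
    rw [map_neg, map_div₀, h]
    field_simp
  set c : Ω := algebraMap K Ω (s / q) with hc
  have hqc : q * c = ∑ i, θs i := by
    rw [hc, map_div₀, map_natCast, hs]
    field_simp
  have hγ (i : Fin q) : (q : Ω) * (θs i - c) = ∑ j, (θs i - θs j) := by
    rw [sum_sub_distrib, ← hqc]
    simp [mul_sub]
  have hγ0 (i : Fin q) : θs i - c ≠ 0 := by
    intro h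
    have hfix (j : Fin q) : θs j = c := by
      obtain ⟨σ, hσ⟩ := hconj i j
      rw [← hσ, sub_eq_zero.1 h, hc, AlgEquiv.commutes]
    have := hinj ((hfix ⟨0, hq.pos⟩).trans (hfix ⟨1, hq.one_lt⟩).symm)
    simp at this
  obtain ⟨m, hm⟩ := hunram (θs ⟨0, hq.pos⟩ - c)
    (sub_mem (IntermediateField.mem_adjoin_simple_self K _) (algebraMap_mem _ _)) (hγ0 _)
  have hγm (i : Fin q) : v (θs i - c) = m := by
    obtain ⟨σ, hσ⟩ := hconj ⟨0, hq.pos⟩ i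
    rw [← hm, ← hinv σ (θs ⟨0, hq.pos⟩ - c), map_sub, hσ, hc, AlgEquiv.commutes]
  have hdiff (i j : Fin q) (hij : i ≠ j) : v (θs i - θs j) = m := by
    have hne : θs i - θs j ≠ 0 := sub_ne_zero.2 (hinj.ne hij)
    refine le_antisymm (not_lt.1 fun hlt ↦ ?_) ?_
    · have hH (σ : Ω ≃ₐ[K] Ω) (x : Ω) (hx : x ∈ hv.ball m) : σ x ∈ hv.ball m := by
        intro h
        rw [hinv]
        exact hx (by simpa using h)
      have hall (k : Fin q) : θs i - θs k ∈ hv.ball m :=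
        sub_mem_of_prime_natDegree hirr (hdeg ▸ hq) _ hH ((hmem _).2 ⟨i, rfl⟩)
          ((hmem _).2 ⟨j, rfl⟩) (hinj.ne hij) (fun _ ↦ hlt) ((hmem _).2 ⟨k, rfl⟩)
      have hsum := (hv.ball m).sum_mem fun k (_ : k ∈ univ) ↦ hall k
      rw [← hγ i] at hsum
      have := hsum (mul_ne_zero hq0 (hγ0 i))
      rw [hmul _ _ hq0 (hγ0 i), hvq, hγm, zero_add] at this
      exact lt_irrefl _ this
    · have h := hadd (θs i - c) (-(θs j - c)) (hγ0 i) (neg_ne_zero.2 (hγ0 j))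
        (by convert hne using 1; ring)
      rw [hv.map_neg, hγm, hγm, min_self] at h
      rwa [← sub_eq_add_neg, sub_sub_sub_cancel_right] at h
  have hprod : v Δ = ∑ i : Fin q, ∑ j ∈ Ioi i, 2 * (m : ℚ) := by
    have hne (i j : Fin q) (hj : j ∈ Ioi i) : θs i - θs j ≠ 0 :=
      sub_ne_zero.2 (hinj.ne (mem_Ioi.1 hj).ne)
    rw [hΔ, hv.map_prod _ _ fun i _ ↦ prod_ne_zero_iff.2 fun j hj ↦ pow_ne_zero _ (hne i j hj)]
    refine sum_congr rfl fun i _ ↦ ?_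
    rw [hv.map_prod _ _ fun j hj ↦ pow_ne_zero _ (hne i j hj)]
    refine sum_congr rfl fun j hj ↦ ?_
    rw [hv.map_pow (hne i j hj), hdiff i j (mem_Ioi.1 hj).ne]
    norm_num
  refine ⟨m, ?_⟩
  rw [hprod, ← two_mul_sum_card_Ioi]
  simp only [sum_const, nsmul_eq_mul]
  push_cast
  rw [← sum_mul]
  ring
end

section
/- In the quadratic extension $\mathbb{Q}_3(\sqrt{-3})$ of $\mathbb{Q}_3$: for any $a, b \in \mathbb{Z}_3$ with $a$ a unit, $(a + b\sqrt{-3})^3 \equiv a^3 \pmod 9$. Consequently, a unit $c \in \mathbb{Z}_3[\sqrt{-3}]^\times$ is a cube in $\mathbb{Q}_3(\sqrt{-3})$ if and only if $c \equiv \pm 1 \pmod 9$. -/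
@[simp]
theorem PadicInt.coe_ofNat {p : ℕ} [Fact p.Prime] (n : ℕ) [n.AtLeastTwo] :
    ((ofNat(n) : ℤ_[p]) : ℚ_[p]) = ofNat(n) :=
  map_ofNat PadicInt.Coe.ringHom n

/-- Every `3`-adic integer is congruent to `0`, `1` or `-1` modulo `3`. -/
theorem PadicInt.exists_eq_three_mul (u : ℤ_[3]) :
    ∃ k : ℤ_[3], u = 3 * k ∨ u = 3 * k + 1 ∨ u = 3 * k - 1 := by
  obtain ⟨n, hn, h⟩ := PadicInt.exists_mem_range u
  rw [PadicInt.maximalIdeal_eq_span_p, Ideal.mem_span_singleton] at h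
  obtain ⟨k, hk⟩ := h
  push_cast at hk
  interval_cases n
  · exact ⟨k, Or.inl (by push_cast at hk; linear_combination hk)⟩
  · exact ⟨k, Or.inr (Or.inl (by push_cast at hk; linear_combination hk))⟩
  · exact ⟨k + 1, Or.inr (Or.inr (by push_cast at hk; linear_combination hk))⟩

/-- Every unit of `ℤ_[3]` is congruent to `1` or `-1` modulo `3`. -/
theorem PadicInt.exists_eq_three_mul_of_isUnit {u : ℤ_[3]} (hu : IsUnit u) :
    ∃ k : ℤ_[3], u = 3 * k + 1 ∨ u = 3 * k - 1 := by
  obtain ⟨k, h | h⟩ := PadicInt.exists_eq_three_mul u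
  · rw [h] at hu
    exact absurd (isUnit_of_mul_isUnit_left hu) (by simpa using PadicInt.p_nonunit (p := 3))
  · exact ⟨k, h⟩

/-- If `a` is a unit of `ℤ_[3]`, then `b * (a ^ 2 - b ^ 2)` is divisible by `3`. -/
theorem PadicInt.three_dvd_mul_sq_sub_sq {a : ℤ_[3]} (ha : IsUnit a) (b : ℤ_[3]) :
    3 ∣ b * (a ^ 2 - b ^ 2) := by
  obtain ⟨l, hl⟩ : (3 : ℤ_[3]) ∣ a ^ 2 - 1 := by
    obtain ⟨k, rfl | rfl⟩ := PadicInt.exists_eq_three_mul_of_isUnit ha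
    · exact ⟨3 * k ^ 2 + 2 * k, by ring⟩
    · exact ⟨3 * k ^ 2 - 2 * k, by ring⟩
  obtain ⟨m, hm⟩ : (3 : ℤ_[3]) ∣ b * (1 - b ^ 2) := by
    obtain ⟨k, rfl | rfl | rfl⟩ := PadicInt.exists_eq_three_mul b
    · exact ⟨k * (1 - (3 * k) ^ 2), by ring⟩
    · exact ⟨-(3 * k + 1) * k * (3 * k + 2), by ring⟩
    · exact ⟨-(3 * k - 1) * k * (3 * k - 2), by ring⟩
  exact ⟨b * l + m, by linear_combination b * hl + hm⟩

/-- The cube of a unit of `ℤ_[3]` is congruent to `1` or `-1` modulo `9`. -/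
theorem PadicInt.exists_pow_three_eq_of_isUnit {u : ℤ_[3]} (hu : IsUnit u) :
    ∃ k : ℤ_[3], u ^ 3 = 9 * k + 1 ∨ u ^ 3 = 9 * k - 1 := by
  obtain ⟨k, rfl | rfl⟩ := PadicInt.exists_eq_three_mul_of_isUnit hu
  · exact ⟨3 * k ^ 3 + 3 * k ^ 2 + k, Or.inl (by ring)⟩
  · exact ⟨3 * k ^ 3 - 3 * k ^ 2 + k, Or.inr (by ring)⟩

/-- The square of a norm of a `3`-adic number is never `3⁻¹`. -/
theorem Padic.norm_sq_ne_inv_three (w : ℚ_[3]) : ‖w‖ ^ 2 ≠ 3⁻¹ := by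
  intro h
  have hw : w ≠ 0 := by
    rintro rfl
    norm_num at h
  rw [Padic.norm_eq_zpow_neg_valuation hw, ← zpow_natCast, ← zpow_mul, ← zpow_neg_one] at h
  push_cast at h
  have := zpow_right_injective₀ (a := (3 : ℝ)) (by norm_num) (by norm_num) h
  omega

theorem Padic.norm_three : ‖(3 : ℚ_[3])‖ = 3⁻¹ := by
  simpa using Padic.norm_p (p := 3)

/-- If `u ^ 2 + 3 * v ^ 2` has norm one, then `u` and `v` are `3`-adic integers. -/
theorem Padic.norm_le_one_of_norm_sq_add_three_mul_sq {u v : ℚ_[3]}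
    (h : ‖u ^ 2 + 3 * v ^ 2‖ = 1) : ‖u‖ ≤ 1 ∧ ‖v‖ ≤ 1 := by
  have hmax : max (‖u‖ ^ 2) (3⁻¹ * ‖v‖ ^ 2) = 1 := by
    by_cases hv : v = 0
    · subst hv
      have hu : ‖u‖ ^ 2 = 1 := by simpa using h
      simp [hu]
    · have hne : ‖u ^ 2‖ ≠ ‖3 * v ^ 2‖ := by
        intro h'
        rw [norm_mul, norm_pow, norm_pow, Padic.norm_three] at h'
        apply Padic.norm_sq_ne_inv_three (u / v)
        have : ‖v‖ ≠ 0 := norm_ne_zero_iff.mpr hv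
        rw [norm_div, div_pow, h']
        field_simp
      rw [Padic.add_eq_max_of_ne hne, norm_mul, norm_pow, norm_pow, Padic.norm_three] at h
      exact h
  have hu : ‖u‖ ^ 2 ≤ 1 := hmax ▸ le_max_left _ _
  have hv : 3⁻¹ * ‖v‖ ^ 2 ≤ 1 := hmax ▸ le_max_right _ _
  refine ⟨by nlinarith [norm_nonneg u], ?_⟩
  have hlt : ‖v‖ < 3 := by nlinarith [norm_nonneg v]
  simpa using (Padic.norm_le_pow_iff_norm_lt_pow_add_one v 0).mpr (by simpa using hlt)

/-- Solvability of `δ + 3 * δ ^ 2 + 3 * δ ^ 3 = γ` in `ℤ_[3][√-3]`, written in coordinates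
`δ = x + y * √-3` and `γ = c + d * √-3`. -/
theorem PadicInt.exists_add_three_mul_sq_add_three_mul_cube (c d : ℤ_[3]) :
    ∃ x y : ℤ_[3],
      x + 3 * (x ^ 2 - 3 * y ^ 2 + (x ^ 3 - 9 * x * y ^ 2)) = c ∧
      y + 3 * (2 * x * y + (3 * x ^ 2 * y - 3 * y ^ 3)) = d := by
  let T : ℤ_[3] × ℤ_[3] → ℤ_[3] × ℤ_[3] := fun z =>
    (c - 3 * (z.1 ^ 2 - 3 * z.2 ^ 2 + (z.1 ^ 3 - 9 * z.1 * z.2 ^ 2)),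
      d - 3 * (2 * z.1 * z.2 + (3 * z.1 ^ 2 * z.2 - 3 * z.2 ^ 3)))
  have h3 : ‖(3 : ℤ_[3])‖ = 3⁻¹ := by simpa using PadicInt.norm_p (p := 3)
  have key (A B r t : ℤ_[3]) {w : ℤ_[3]} (hw : w = 3 * (A * r + B * t)) :
      ‖w‖ ≤ 3⁻¹ * max ‖r‖ ‖t‖ := by
    rw [hw, norm_mul, h3]
    gcongr
    refine (PadicInt.nonarchimedean _ _).trans (max_le_max ?_ ?_) <;> rw [norm_mul]
    · exact mul_le_of_le_one_left (norm_nonneg _) (PadicInt.norm_le_one _)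
    · exact mul_le_of_le_one_left (norm_nonneg _) (PadicInt.norm_le_one _)
  have hT : ContractingWith 3⁻¹ T := by
    refine ⟨by rw [← NNReal.coe_lt_coe]; norm_num, LipschitzWith.of_dist_le_mul ?_⟩
    rintro ⟨x, y⟩ ⟨x', y'⟩
    rw [Prod.dist_eq, Prod.dist_eq]
    simp only [dist_eq_norm, T, NNReal.coe_inv, NNReal.coe_ofNat]
    refine max_le ?_ ?_
    · exact key (-(x + x' + (x ^ 2 + x * x' + x' ^ 2) - 9 * y ^ 2))
        (3 * (y + y') + 9 * x' * (y + y')) (x - x') (y - y') (by ring)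
    · exact key (-(2 * y + 3 * (x + x') * y))
        (-(2 * x' + 3 * x' ^ 2 - 3 * (y ^ 2 + y * y' + y' ^ 2))) (x - x') (y - y') (by ring)
  obtain ⟨⟨x, y⟩, hxy⟩ : ∃ z, T z = z := ⟨_, hT.fixedPoint_isFixedPt⟩
  have h1 := congrArg Prod.fst hxy
  have h2 := congrArg Prod.snd hxy
  simp only [T] at h1 h2
  exact ⟨x, y, by linear_combination -h1, by linear_combination -h2⟩

section QuadraticExtension

variable {F : Type*} [Field F] [Algebra ℚ_[3] F] {s : F}

theorem eq_of_algebraMap_add_mul_sqrt_neg_three_eq (hs : s ^ 2 = -3) {u v u' v' : ℚ_[3]}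
    (h : algebraMap ℚ_[3] F u + algebraMap ℚ_[3] F v * s =
      algebraMap ℚ_[3] F u' + algebraMap ℚ_[3] F v' * s) : u = u' ∧ v = v' := by
  have hv : v = v' := by
    by_contra hne
    have hne' : v - v' ≠ 0 := sub_ne_zero.mpr hne
    have hsw : s = algebraMap ℚ_[3] F ((u' - u) / (v - v')) := by
      have : algebraMap ℚ_[3] F (v - v') ≠ 0 :=
        (map_ne_zero _).mpr hne'
      rw [map_div₀, eq_div_iff this, map_sub, map_sub]
      linear_combination h
    have hw : ((u' - u) / (v - v')) ^ 2 = (-3 : ℚ_[3]) := by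
      apply (algebraMap ℚ_[3] F).injective
      rw [map_pow, ← hsw, hs]
      simp only [map_neg, map_ofNat]
    apply Padic.norm_sq_ne_inv_three ((u' - u) / (v - v'))
    rw [← norm_pow, hw, norm_neg, Padic.norm_three]
  subst hv
  exact ⟨(algebraMap ℚ_[3] F).injective (add_right_cancel h), rfl⟩

theorem exists_eq_algebraMap_add_mul_sqrt_neg_three (hs : s ^ 2 = -3)
    (hgen : Algebra.adjoin ℚ_[3] {s} = ⊤) (x : F) :
    ∃ u v : ℚ_[3], x = algebraMap ℚ_[3] F u + algebraMap ℚ_[3] F v * s := by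
  have hx : x ∈ Algebra.adjoin ℚ_[3] {s} := hgen ▸ Algebra.mem_top
  induction hx using Algebra.adjoin_induction with
  | mem x hx =>
    obtain rfl := hx
    exact ⟨0, 1, by simp⟩
  | algebraMap r => exact ⟨r, 0, by simp⟩
  | add x y _ _ hx hy =>
    obtain ⟨u, v, rfl⟩ := hx
    obtain ⟨u', v', rfl⟩ := hy
    exact ⟨u + u', v + v', by simp only [map_add]; ring⟩
  | mul x y _ _ hx hy =>
    obtain ⟨u, v, rfl⟩ := hx
    obtain ⟨u', v', rfl⟩ := hy
    refine ⟨u * u' - 3 * v * v', u * v' + v * u', ?_⟩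
    simp only [map_add, map_sub, map_mul, map_ofNat]
    linear_combination algebraMap ℚ_[3] F v * algebraMap ℚ_[3] F v' * hs

theorem algebraMap_add_mul_sqrt_neg_three_pow_three (hs : s ^ 2 = -3) (u v : ℚ_[3]) :
    (algebraMap ℚ_[3] F u + algebraMap ℚ_[3] F v * s) ^ 3 =
      algebraMap ℚ_[3] F (u ^ 3 - 9 * u * v ^ 2) +
        algebraMap ℚ_[3] F (3 * (v * (u ^ 2 - v ^ 2))) * s := by
  simp only [map_sub, map_mul, map_pow, map_ofNat]
  linear_combination (3 * algebraMap ℚ_[3] F u * algebraMap ℚ_[3] F v ^ 2 +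
    algebraMap ℚ_[3] F v ^ 3 * s) * hs

theorem exists_pow_three_eq_one_add_nine_mul (hs : s ^ 2 = -3) (c d : ℤ_[3]) :
    ∃ x : F, x ^ 3 = 1 + 9 * (algebraMap ℚ_[3] F c + algebraMap ℚ_[3] F d * s) := by
  obtain ⟨x, y, rfl, rfl⟩ := PadicInt.exists_add_three_mul_sq_add_three_mul_cube c d
  refine ⟨algebraMap ℚ_[3] F (1 + 3 * x) + algebraMap ℚ_[3] F (3 * y) * s, ?_⟩
  rw [algebraMap_add_mul_sqrt_neg_three_pow_three hs]
  simp only [PadicInt.coe_add, PadicInt.coe_sub, PadicInt.coe_mul, PadicInt.coe_pow,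
    PadicInt.coe_ofNat, map_add, map_sub, map_mul, map_pow, map_ofNat, map_one]
  ring

/-- The coordinates of a cube root of a unit of `ℤ_[3][√-3]` are integral, and the first one is
a unit. -/
theorem exists_integral_coordinates_of_pow_three_eq (hs : s ^ 2 = -3)
    (hgen : Algebra.adjoin ℚ_[3] {s} = ⊤) {a b : ℤ_[3]} (ha : IsUnit a) {x : F}
    (hx : x ^ 3 = algebraMap ℚ_[3] F a + algebraMap ℚ_[3] F b * s) :
    ∃ u v : ℤ_[3], IsUnit u ∧ a = u ^ 3 - 9 * u * v ^ 2 ∧ b = 3 * (v * (u ^ 2 - v ^ 2)) := by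
  obtain ⟨u, v, rfl⟩ := exists_eq_algebraMap_add_mul_sqrt_neg_three hs hgen x
  rw [algebraMap_add_mul_sqrt_neg_three_pow_three hs] at hx
  obtain ⟨h1, h2⟩ := eq_of_algebraMap_add_mul_sqrt_neg_three_eq hs hx
  have hunit : IsUnit (a ^ 2 + 3 * b ^ 2) := by
    by_contra hn
    have h3 : (3 : ℤ_[3]) ∈ nonunits ℤ_[3] := by simpa using PadicInt.p_nonunit (p := 3)
    have h3b : 3 * b ^ 2 ∈ IsLocalRing.maximalIdeal ℤ_[3] := Ideal.mul_mem_right _ _ h3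
    have hmem : a ^ 2 ∈ IsLocalRing.maximalIdeal ℤ_[3] := by
      simpa using Ideal.sub_mem _ (show _ ∈ IsLocalRing.maximalIdeal ℤ_[3] from hn) h3b
    exact hmem (ha.pow 2)
  have hnorm : ‖u ^ 2 + 3 * v ^ 2‖ = 1 := by
    have h : (u ^ 2 + 3 * v ^ 2) ^ 3 = ((a ^ 2 + 3 * b ^ 2 : ℤ_[3]) : ℚ_[3]) := by
      simp only [PadicInt.coe_add, PadicInt.coe_mul, PadicInt.coe_pow, PadicInt.coe_ofNat]
      rw [← h1, ← h2]
      ring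
    have h' : ‖u ^ 2 + 3 * v ^ 2‖ ^ 3 = 1 := by
      rw [← norm_pow, h, ← PadicInt.norm_def, PadicInt.isUnit_iff.mp hunit]
    exact (pow_eq_one_iff_of_nonneg (norm_nonneg _) (by norm_num)).mp h'
  obtain ⟨hu, hv⟩ := Padic.norm_le_one_of_norm_sq_add_three_mul_sq hnorm
  obtain ⟨u, rfl⟩ : ∃ u' : ℤ_[3], (u' : ℚ_[3]) = u := ⟨⟨u, hu⟩, rfl⟩
  obtain ⟨v, rfl⟩ : ∃ v' : ℤ_[3], (v' : ℚ_[3]) = v := ⟨⟨v, hv⟩, rfl⟩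
  have h1' : a = u ^ 3 - 9 * u * v ^ 2 := Subtype.ext (by simpa using h1.symm)
  have h2' : b = 3 * (v * (u ^ 2 - v ^ 2)) := Subtype.ext (by simpa using h2.symm)
  refine ⟨u, v, isUnit_of_dvd_unit ⟨u ^ 2 - 9 * v ^ 2, ?_⟩ ha, h1', h2'⟩
  rw [h1']
  ring

end QuadraticExtension


/-- In `ℚ₃(√-3)`: for `a, b ∈ ℤ₃` with `a` a unit, `(a + b√-3)³ ≡ a³ (mod 9)` in
`ℤ₃[√-3]`; consequently a unit `c = a + b√-3` of `ℤ₃[√-3]` is a cube in `ℚ₃(√-3)`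
iff `c ≡ ±1 (mod 9 ℤ₃[√-3])`. -/
theorem stmt_14 (F : Type) [Field F] [Algebra ℚ_[3] F]
    (s : F) (hs : s ^ 2 = -3)
    (hgen : Algebra.adjoin ℚ_[3] {s} = ⊤) :
    (∀ a b : ℤ_[3], IsUnit a →
      ∃ c d : ℤ_[3],
        (algebraMap ℚ_[3] F (a : ℚ_[3]) + algebraMap ℚ_[3] F (b : ℚ_[3]) * s) ^ 3 -
            algebraMap ℚ_[3] F ((a : ℚ_[3]) ^ 3) =
          9 * (algebraMap ℚ_[3] F (c : ℚ_[3]) + algebraMap ℚ_[3] F (d : ℚ_[3]) * s)) ∧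
    (∀ a b : ℤ_[3], IsUnit a →
      ((∃ x : F, x ^ 3 =
          algebraMap ℚ_[3] F (a : ℚ_[3]) + algebraMap ℚ_[3] F (b : ℚ_[3]) * s) ↔
        ∃ c d : ℤ_[3],
          (algebraMap ℚ_[3] F (a : ℚ_[3]) + algebraMap ℚ_[3] F (b : ℚ_[3]) * s - 1 =
              9 * (algebraMap ℚ_[3] F (c : ℚ_[3]) + algebraMap ℚ_[3] F (d : ℚ_[3]) * s)) ∨
          (algebraMap ℚ_[3] F (a : ℚ_[3]) + algebraMap ℚ_[3] F (b : ℚ_[3]) * s + 1 =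
              9 * (algebraMap ℚ_[3] F (c : ℚ_[3]) + algebraMap ℚ_[3] F (d : ℚ_[3]) * s)))) := by
  refine ⟨fun a b ha => ?_, fun a b ha => ⟨?_, ?_⟩⟩
  · obtain ⟨e, he⟩ := PadicInt.three_dvd_mul_sq_sub_sq ha b
    have he' : (b * (a ^ 2 - b ^ 2) : ℚ_[3]) = 3 * e := by exact_mod_cast congrArg _ he
    refine ⟨-(a * b ^ 2), e, ?_⟩
    rw [algebraMap_add_mul_sqrt_neg_three_pow_three hs, he']
    simp only [PadicInt.coe_neg, PadicInt.coe_mul, PadicInt.coe_pow, map_sub, map_mul, map_pow,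
      map_neg, map_ofNat]
    ring
  · rintro ⟨x, hx⟩
    obtain ⟨u, v, hu, rfl, rfl⟩ := exists_integral_coordinates_of_pow_three_eq hs hgen ha hx
    obtain ⟨e, he⟩ := PadicInt.three_dvd_mul_sq_sub_sq hu v
    obtain ⟨k, hk⟩ := PadicInt.exists_pow_three_eq_of_isUnit hu
    refine ⟨k - u * v ^ 2, e, hk.imp (fun hk => ?_) (fun hk => ?_)⟩ <;>
    · rw [he, hk]
      simp only [PadicInt.coe_add, PadicInt.coe_sub, PadicInt.coe_mul, PadicInt.coe_pow,
        PadicInt.coe_one, PadicInt.coe_ofNat, map_add, map_sub, map_mul, map_pow, map_ofNat,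
        map_one]
      ring
  · rintro ⟨c, d, h | h⟩
    · obtain ⟨x, hx⟩ := exists_pow_three_eq_one_add_nine_mul hs c d
      exact ⟨x, by linear_combination hx - h⟩
    · obtain ⟨x, hx⟩ := exists_pow_three_eq_one_add_nine_mul hs (-c) (-d)
      refine ⟨-x, ?_⟩
      simp only [PadicInt.coe_neg, map_neg] at hx
      linear_combination -hx - h
end
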